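/- Let X be a complex Banach space, p > 0, let (I,‖·‖_I) be an l_p-ideal in B(X) with eigenvalue constant γ_p, let Γ_p > 0 satisfy |det_p(I−F)| ≤ exp(Γ_p ∑_j |λ_j(F)|^p) for all finite rank F on X, and let A ∈ B(X), K ∈ I. Suppose that for some R ≥ r(A) (the spectral radius of A) and C_A > 0 one has ‖(λ−A)^{-1}‖ ≤ C_A/(|λ|−R) for all |λ| > R. Then for every s > R, the number n_{A+K}(s) of discrete eigenvalues of A+K in {λ : |λ| > s}, counted with algebraic multiplicity, satisfies n_{A+K}(s) ≤ C_A^p γ_p^p Γ_p · ((p+1)^{p+1}/p^p) · s/(s−R)^{p+1} · ‖K‖_I^p. -/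

import Mathlib

open scoped ENNReal

variable {X : Type*} [NormedAddCommGroup X] [NormedSpace ℂ X] [CompleteSpace X]

/-- A continuous linear operator has finite rank. -/
def IsFiniteRank (F : X →L[ℂ] X) : Prop :=
  FiniteDimensional ℂ (LinearMap.range (F : X →ₗ[ℂ] X))

/-- `det(I - F)`, defined as the determinant of the restriction of `I - F` to the
(finite-dimensional) range of `F`. -/
noncomputable def detOneSub (F : X →L[ℂ] X) : ℂ :=
  LinearMap.det
    ((LinearMap.id : LinearMap.range (F : X →ₗ[ℂ] X) →ₗ[ℂ] LinearMap.range (F : X →ₗ[ℂ] X)) -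
      (F : X →ₗ[ℂ] X).restrict fun x _ => LinearMap.mem_range_self _ x)

/-- `tr F`, the trace of the restriction of `F` to its range. -/
noncomputable def trOn (F : X →L[ℂ] X) : ℂ :=
  LinearMap.trace ℂ (LinearMap.range (F : X →ₗ[ℂ] X))
    ((F : X →ₗ[ℂ] X).restrict fun x _ => LinearMap.mem_range_self _ x)

/-- The `p`-regularized determinant `det_p(I-F)` of a finite rank operator. -/
noncomputable def detp (p : ℝ) (F : X →L[ℂ] X) : ℂ :=
  detOneSub F * Complex.exp (∑ k ∈ Finset.Icc 1 (⌈p⌉₊ - 1), trOn (F ^ k) / (k : ℂ))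

open scoped ENNReal

variable {X : Type*} [NormedAddCommGroup X] [NormedSpace ℂ X] [CompleteSpace X]

/-- The Riesz projection of `T` at `μ`, computed with the circle of radius `r` around `μ`. -/
noncomputable def rieszProjection (T : X →L[ℂ] X) (μ : ℂ) (r : ℝ) : X →L[ℂ] X :=
  (2 * Real.pi * Complex.I)⁻¹ • ∮ z in C(μ, r), resolvent T z

/-- `μ` is a discrete eigenvalue of `T`: an isolated point of the spectrum whose
Riesz projection has finite-dimensional range. -/
def IsDiscreteEigenvalue (T : X →L[ℂ] X) (μ : ℂ) : Prop :=
  μ ∈ spectrum ℂ T ∧ ∃ r, 0 < r ∧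
    (∀ z ∈ Metric.closedBall μ r, z ≠ μ → z ∉ spectrum ℂ T) ∧
    FiniteDimensional ℂ (LinearMap.range ((rieszProjection T μ r : X →L[ℂ] X) : X →ₗ[ℂ] X))

open scoped Classical in
/-- The algebraic multiplicity of `μ`: the dimension of the range of the Riesz projection
computed with a radius isolating `μ` from the rest of the spectrum. -/
noncomputable def algebraicMultiplicity (T : X →L[ℂ] X) (μ : ℂ) : ℕ :=
  if h : ∃ r, 0 < r ∧ ∀ z ∈ Metric.closedBall μ r, z ≠ μ → z ∉ spectrum ℂ T then
    Module.finrank ℂ (LinearMap.range ((rieszProjection T μ h.choose : X →L[ℂ] X) : X →ₗ[ℂ] X))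
  else 0

/-- `∑_j |λ_j(T)|^p`, the sum over the discrete eigenvalues of `T`, counted with
algebraic multiplicity (as an extended nonnegative real). -/
noncomputable def eigSum (p : ℝ) (T : X →L[ℂ] X) : ℝ≥0∞ :=
  ∑' μ : {μ : ℂ // IsDiscreteEigenvalue T μ},
    (algebraicMultiplicity T (μ : ℂ) : ℝ≥0∞) * ENNReal.ofReal (‖(μ : ℂ)‖ ^ p)

/-- The number of discrete eigenvalues of `T` in the set `S`, counted with algebraic
multiplicity (as an extended nonnegative real). -/
noncomputable def eigCount (T : X →L[ℂ] X) (S : Set ℂ) : ℝ≥0∞ :=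
  ∑' μ : {μ : ℂ // μ ∈ S ∧ IsDiscreteEigenvalue T μ},
    (algebraicMultiplicity T (μ : ℂ) : ℝ≥0∞)

/-- An `l_p`-ideal in `B(X)`: a quasi-normed subspace (with quasi-norm `norm'` and
quasi-triangle constant `q`) of the bounded operators on `X` in which the finite rank
operators are dense (A1), whose quasi-norm dominates the operator norm (A2), which is a
two-sided ideal with submultiplicative quasi-norm (A3), and whose members have
`l_p`-summable discrete eigenvalue sequences, with eigenvalue constant `γ` (A4). -/
structure LpIdeal (p : ℝ) (X : Type*) [NormedAddCommGroup X] [NormedSpace ℂ X]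
    [CompleteSpace X] where
  carrier : Set (X →L[ℂ] X)
  norm' : (X →L[ℂ] X) → ℝ
  q : ℝ
  γ : ℝ
  one_le_q : 1 ≤ q
  γ_nonneg : 0 ≤ γ
  add_mem : ∀ {K L : X →L[ℂ] X}, K ∈ carrier → L ∈ carrier → K + L ∈ carrier
  smul_mem : ∀ (c : ℂ) {L : X →L[ℂ] X}, L ∈ carrier → c • L ∈ carrier
  norm'_nonneg : ∀ L ∈ carrier, 0 ≤ norm' L
  norm'_eq_zero_iff : ∀ L ∈ carrier, (norm' L = 0 ↔ L = 0)
  norm'_smul : ∀ L ∈ carrier, ∀ c : ℂ, norm' (c • L) = ‖c‖ * norm' L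
  norm'_add_le : ∀ K ∈ carrier, ∀ L ∈ carrier, norm' (K + L) ≤ q * (norm' K + norm' L)
  finiteRank_mem : ∀ F : X →L[ℂ] X, IsFiniteRank F → F ∈ carrier
  dense_finiteRank : ∀ L ∈ carrier, ∀ ε > 0, ∃ F : X →L[ℂ] X, IsFiniteRank F ∧ norm' (L - F) < ε
  opNorm_le : ∀ L ∈ carrier, ‖L‖ ≤ norm' L
  mul_mem : ∀ L ∈ carrier, ∀ A B : X →L[ℂ] X, A * L * B ∈ carrier
  mul_norm'_le : ∀ L ∈ carrier, ∀ A B : X →L[ℂ] X, norm' (A * L * B) ≤ ‖A‖ * norm' L * ‖B‖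
  eig_le : ∀ L ∈ carrier, eigSum p L ≤ ENNReal.ofReal ((γ * norm' L) ^ p)

/-- `D` is continuous on the ideal `I` with respect to the quasi-norm of `I`. -/
def IdealContinuous {p : ℝ} (I : LpIdeal p X) (D : (X →L[ℂ] X) → ℂ) : Prop :=
  ∀ L ∈ I.carrier, ∀ ε > 0, ∃ δ > 0, ∀ K ∈ I.carrier, I.norm' (K - L) < δ → ‖D K - D L‖ < ε

/-- `D` agrees with the `p`-regularized determinant on the finite rank operators. -/
def ExtendsDetp (p : ℝ) (D : (X →L[ℂ] X) → ℂ) : Prop :=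
  ∀ F : X →L[ℂ] X, IsFiniteRank F → D F = detp p F

set_option linter.unusedSectionVars false

open Polynomial in
theorem Matrix.det_aeval_eq_prod_roots {k : ℕ} (M : Matrix (Fin k) (Fin k) ℂ) (q : ℂ[X]) :
    (aeval M q).det = (M.charpoly.roots.map fun ν => q.eval ν).prod := by
  have hcard : M.charpoly.roots.card = k := by
    rw [IsAlgClosed.card_roots_eq_natDegree, Matrix.charpoly_natDegree_eq_dim, Fintype.card_fin]
  have hlin : ∀ α : ℂ, (aeval M (X - C α)).det =
      (M.charpoly.roots.map fun ν => (X - C α : ℂ[X]).eval ν).prod := by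
    intro α
    have h1 := Matrix.eval_charpoly M α
    have h2 := (IsAlgClosed.splits M.charpoly).eval_eq_prod_roots_of_monic M.charpoly_monic α
    have h3 : (aeval M (X - C α)) = -(Matrix.scalar (Fin k) α - M) := by
      simp [Matrix.algebraMap_eq_diagonal]
    rw [h3, Matrix.det_neg, ← h1, h2, Fintype.card_fin]
    have : (M.charpoly.roots.map fun ν => (X - C α : ℂ[X]).eval ν) =
        (M.charpoly.roots.map fun ν => (-1) * (α - ν)) := by
      congr 1; ext ν; simp
    rw [this, Multiset.prod_map_mul]
    simp [hcard]
  have hq := (IsAlgClosed.splits q).eq_prod_roots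
  rw [hq]
  generalize q.leadingCoeff = a
  generalize q.roots = s
  induction s using Multiset.induction with
  | empty =>
    simp [Matrix.algebraMap_eq_diagonal, hcard]
  | cons α s ih =>
    rw [Multiset.map_cons, Multiset.prod_cons, mul_left_comm, map_mul, Matrix.det_mul, ih, hlin,
      ← Multiset.prod_map_mul]
    simp only [eval_mul]

open Polynomial in
theorem Matrix.roots_charpoly_pow {k : ℕ} (M : Matrix (Fin k) (Fin k) ℂ) (j : ℕ) :
    (M ^ j).charpoly.roots = M.charpoly.roots.map (· ^ j) := by
  have : (M ^ j).charpoly = ((M.charpoly.roots.map (· ^ j)).map fun a => X - C a).prod := by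
    apply Polynomial.funext
    intro z
    have h := Matrix.det_aeval_eq_prod_roots M (C z - X ^ j)
    have h3 : aeval M (C z - X ^ j) = Matrix.scalar (Fin k) z - M ^ j := by
      simp [Matrix.algebraMap_eq_diagonal]
    rw [Matrix.eval_charpoly, ← h3, h, eval_multiset_prod]
    simp
  rw [this, Polynomial.roots_multiset_prod_X_sub_C]

theorem Matrix.trace_pow_eq_sum_roots {k : ℕ} (M : Matrix (Fin k) (Fin k) ℂ) (j : ℕ) :
    (M ^ j).trace = (M.charpoly.roots.map (· ^ j)).sum := by
  rw [Matrix.trace_eq_sum_roots_charpoly, Matrix.roots_charpoly_pow]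

/-- The scalar function `E_m(z)^N (1 + (N/m) z^m)`, where `E_m` is the elementary factor
`(1 - z) exp (∑_{j < m} z^j / j)`. -/
noncomputable def modFactor (m N : ℕ) (z : ℂ) : ℂ :=
  ((1 - z) * Complex.exp (∑ j ∈ Finset.Icc 1 (m - 1), z ^ j / (j : ℂ))) ^ N *
    (1 + (N / m : ℂ) * z ^ m)

/-- The matrix analogue of `modFactor`: the product of `modFactor` over the eigenvalues. -/
noncomputable def modDet {k : ℕ} (m N : ℕ) (M : Matrix (Fin k) (Fin k) ℂ) : ℂ :=
  ((1 - M).det * Complex.exp (∑ j ∈ Finset.Icc 1 (m - 1), (M ^ j).trace / (j : ℂ))) ^ N *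
    (1 + (N / m : ℂ) • M ^ m).det

open Polynomial in
theorem modDet_eq_prod {k : ℕ} (m N : ℕ) (M : Matrix (Fin k) (Fin k) ℂ) :
    modDet m N M = (M.charpoly.roots.map (modFactor m N)).prod := by
  have h1 : (1 - M).det = (M.charpoly.roots.map fun ν => 1 - ν).prod := by
    have h := Matrix.det_aeval_eq_prod_roots M (1 - X)
    simp only [map_sub, map_one, aeval_X, eval_sub, eval_one, eval_X] at h
    exact h
  have h2 : (1 + (N / m : ℂ) • M ^ m).det =
      (M.charpoly.roots.map fun ν => 1 + (N / m : ℂ) * ν ^ m).prod := by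
    have h := Matrix.det_aeval_eq_prod_roots M (1 + (N / m : ℂ) • X ^ m)
    simp only [map_add, map_one, map_smul, map_pow, aeval_X, eval_add, eval_one, eval_smul,
      eval_pow, eval_X, smul_eq_mul] at h
    exact h
  have h3 : Complex.exp (∑ j ∈ Finset.Icc 1 (m - 1), (M ^ j).trace / (j : ℂ)) =
      (M.charpoly.roots.map fun ν =>
        Complex.exp (∑ j ∈ Finset.Icc 1 (m - 1), ν ^ j / (j : ℂ))).prod := by
    simp only [Matrix.trace_pow_eq_sum_roots]
    induction M.charpoly.roots using Multiset.induction with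
    | empty => simp
    | cons a s ih =>
      simp only [Multiset.map_cons, Multiset.sum_cons, Multiset.prod_cons, add_div,
        Finset.sum_add_distrib, Complex.exp_add, ih]
  unfold modDet modFactor
  rw [h1, h2, h3, ← Multiset.prod_map_mul, ← Multiset.prod_map_pow, ← Multiset.prod_map_mul]

theorem Complex.norm_one_add_le_exp (y : ℂ) : ‖1 + y‖ ≤ Real.exp (y.re + ‖y‖ ^ 2 / 2) := by
  have h1 : ‖1 + y‖ ^ 2 = 1 + (2 * y.re + ‖y‖ ^ 2) := by
    rw [← Complex.normSq_eq_norm_sq, ← Complex.normSq_eq_norm_sq, Complex.normSq_add]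
    simp
    ring
  have h2 : ‖1 + y‖ ^ 2 ≤ Real.exp (y.re + ‖y‖ ^ 2 / 2) ^ 2 := by
    rw [h1, ← Real.exp_nat_mul, add_comm 1]
    refine (Real.add_one_le_exp _).trans (Real.exp_le_exp.2 (le_of_eq ?_))
    push_cast; ring
  exact le_of_sq_le_sq h2 (Real.exp_pos _).le

theorem norm_elementaryFactor_le_of_norm_le_half {m : ℕ} (hm : 1 ≤ m) {z : ℂ}
    (hz : ‖z‖ ≤ 1 / 2) :
    ‖(1 - z) * Complex.exp (∑ j ∈ Finset.Icc 1 (m - 1), z ^ j / (j : ℂ))‖ ≤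
      Real.exp (-(z ^ m).re / m + 2 * ‖z‖ ^ (m + 1)) := by
  have hz1 : ‖-z‖ < 1 := by rw [norm_neg]; linarith
  have hne : (1 - z) ≠ 0 := by
    intro h
    have : z = 1 := by linear_combination -h
    rw [this] at hz; norm_num at hz
  have h := Complex.norm_log_sub_logTaylor_le m hz1
  have hT : Complex.logTaylor (m + 1) (-z) =
      -(∑ j ∈ Finset.Icc 1 (m - 1), z ^ j / (j : ℂ)) - z ^ m / m := by
    obtain ⟨n, rfl⟩ : ∃ n, m = n + 1 := ⟨m - 1, by omega⟩
    have : ∀ n : ℕ, Complex.logTaylor (n + 1) (-z) = -∑ j ∈ Finset.Icc 1 n, z ^ j / (j : ℂ) := by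
      intro n
      induction n with
      | zero => simp [Complex.logTaylor_succ, Complex.logTaylor_zero]
      | succ n ih =>
        rw [Complex.logTaylor_succ]
        simp only [Pi.add_apply]
        rw [ih, Finset.sum_Icc_succ_top (by omega), neg_pow z]
        have : (-1 : ℂ) ^ (n + 1 + 1) * ((-1) ^ (n + 1)) = -1 := by
          rw [pow_succ, mul_right_comm, ← pow_add, ← two_mul, pow_mul]; simp
        linear_combination (z ^ (n + 1) / (n + 1 : ℕ)) * this
    rw [this, Nat.add_sub_cancel, Finset.sum_Icc_succ_top (by omega)]
    ring
  have hexp : (1 - z) * Complex.exp (∑ j ∈ Finset.Icc 1 (m - 1), z ^ j / (j : ℂ)) =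
      Complex.exp ((Complex.log (1 + -z) - Complex.logTaylor (m + 1) (-z)) - z ^ m / m) := by
    rw [hT]
    have : Complex.log (1 + -z) - (-(∑ j ∈ Finset.Icc 1 (m - 1), z ^ j / (j : ℂ)) - z ^ m / m)
        - z ^ m / m = Complex.log (1 - z) + ∑ j ∈ Finset.Icc 1 (m - 1), z ^ j / (j : ℂ) := by
      rw [← sub_eq_add_neg]; ring
    rw [this, Complex.exp_add, Complex.exp_log hne]
  rw [hexp, Complex.norm_exp, Real.exp_le_exp, Complex.sub_re]
  have h1 := (Complex.re_le_norm _).trans h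
  have h2 : (z ^ m / (m : ℂ)).re = (z ^ m).re / m := by
    rw [← Complex.ofReal_natCast, Complex.div_ofReal_re]
  rw [h2, neg_div]
  have h3 : ‖-z‖ ^ (m + 1) * (1 - ‖-z‖)⁻¹ / (m + 1) ≤ 2 * ‖z‖ ^ (m + 1) := by
    rw [norm_neg]
    have : (1 - ‖z‖)⁻¹ ≤ 2 := by
      rw [inv_le_comm₀ (by linarith) (by norm_num)]; linarith
    calc ‖z‖ ^ (m + 1) * (1 - ‖z‖)⁻¹ / (m + 1) ≤ ‖z‖ ^ (m + 1) * (1 - ‖z‖)⁻¹ := by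
          apply div_le_self
          · have : 0 ≤ (1 - ‖z‖)⁻¹ := inv_nonneg.2 (by linarith)
            positivity
          · norm_cast; omega
      _ ≤ ‖z‖ ^ (m + 1) * 2 := by gcongr
      _ = _ := by ring
  linarith

theorem norm_modFactor_le_of_norm_le {m N : ℕ} (hm : 1 ≤ m) {p ε : ℝ} (hp : 0 < p)
    (hpm : p ≤ m) (hε : ε ≤ 1 / 2) {z : ℂ} (hz : ‖z‖ ≤ ε) :
    ‖modFactor m N z‖ ≤ Real.exp (N * ((2 + N) * ε * ‖z‖ ^ p)) := by
  have hm0 : (1 : ℝ) ≤ m := by exact_mod_cast hm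
  have h1 := norm_elementaryFactor_le_of_norm_le_half hm (hz.trans hε)
  have h2 := Complex.norm_one_add_le_exp ((N / m : ℂ) * z ^ m)
  unfold modFactor
  rw [norm_mul, norm_pow]
  refine (mul_le_mul (pow_le_pow_left₀ (norm_nonneg _) h1 N) h2 (norm_nonneg _)
    (by positivity)).trans ?_
  rw [← Real.exp_nat_mul, ← Real.exp_add, Real.exp_le_exp]
  have h3 : ((N / m : ℂ) * z ^ m).re = N / m * (z ^ m).re := by
    have : (N / m : ℂ) = ((N / m : ℝ) : ℂ) := by push_cast; rfl
    rw [this, Complex.re_ofReal_mul]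
  have h4 : ‖(N / m : ℂ) * z ^ m‖ = N / m * ‖z‖ ^ m := by
    rw [norm_mul, norm_div, norm_pow]; simp
  rw [h3, h4]
  have hz0 := norm_nonneg z
  have h5 : ‖z‖ ^ m ≤ ‖z‖ ^ p := by
    rw [← Real.rpow_natCast]
    rcases hz0.eq_or_lt with h | h
    · rw [← h, Real.zero_rpow hp.ne', Real.zero_rpow (by positivity)]
    · exact Real.rpow_le_rpow_of_exponent_ge h (by linarith) hpm
  have h6 : ‖z‖ ^ m ≤ ε := by
    calc ‖z‖ ^ m ≤ ‖z‖ ^ 1 := pow_le_pow_of_le_one hz0 (by linarith) hm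
      _ ≤ ε := by simpa using hz
  have h7 : 0 ≤ ‖z‖ ^ m := by positivity
  have h8 : 0 ≤ ‖z‖ ^ p := by positivity
  have hε0 : 0 ≤ ε := hz0.trans hz
  have h9 : ‖z‖ ^ (m + 1) ≤ ε * ‖z‖ ^ p := by
    rw [pow_succ, mul_comm]; gcongr
  have h10 : (N / m * ‖z‖ ^ m) ^ 2 / 2 ≤ N * (N * (ε * ‖z‖ ^ p)) := by
    calc (N / m * ‖z‖ ^ m) ^ 2 / 2 ≤ (N / m * ‖z‖ ^ m) ^ 2 := by
          have : 0 ≤ (N / m * ‖z‖ ^ m) ^ 2 := sq_nonneg _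
          linarith
      _ ≤ (N * ‖z‖ ^ m) ^ 2 := by
          gcongr
          exact div_le_self (by positivity) hm0
      _ = N * (N * (‖z‖ ^ m * ‖z‖ ^ m)) := by ring
      _ ≤ N * (N * (ε * ‖z‖ ^ p)) := by gcongr
  have h11 : (N : ℝ) * ‖z‖ ^ (m + 1) ≤ N * (ε * ‖z‖ ^ p) := by gcongr
  have h12 : (N : ℝ) * (-(z ^ m).re / m) + N / m * (z ^ m).re = 0 := by ring
  nlinarith

/-- The correction term `log (1 + (N/m) t^m) / N`. -/
noncomputable def corrTerm (m N : ℕ) (t : ℝ) : ℝ := Real.log (1 + N / m * t ^ m) / N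

theorem corrTerm_nonneg (m N : ℕ) {t : ℝ} (ht : 0 ≤ t) : 0 ≤ corrTerm m N t := by
  unfold corrTerm
  have : 0 ≤ N / m * t ^ m := by positivity
  exact div_nonneg (Real.log_nonneg (by linarith)) (by positivity)

theorem continuous_corrTerm_norm (m N : ℕ) : Continuous fun z : ℂ => corrTerm m N ‖z‖ := by
  unfold corrTerm
  refine Continuous.div_const (Continuous.log (by fun_prop) fun z => ?_) _
  have : 0 ≤ N / m * ‖z‖ ^ m := by positivity
  linarith

theorem corrTerm_le {m N : ℕ} (hm : 1 ≤ m) {p : ℝ} (hp : 0 < p) (hpm : p ≤ m) {t : ℝ}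
    (ht : 0 ≤ t) : corrTerm m N t ≤ m / p * t ^ p := by
  have hm0 : (1 : ℝ) ≤ m := by exact_mod_cast hm
  rcases Nat.eq_zero_or_pos N with rfl | hN
  · simp [corrTerm]; positivity
  have hN1 : (1 : ℝ) ≤ N := by exact_mod_cast hN
  set s := p / m with hs
  have hs0 : 0 < s := by positivity
  have hs1 : s ≤ 1 := by rw [hs, div_le_one (by linarith)]; exact hpm
  set y := N / m * t ^ m with hy
  have hy0 : 0 ≤ y := by positivity
  have h1 : Real.log (1 + y) ≤ y ^ s / s := by
    rw [le_div_iff₀ hs0, mul_comm, ← Real.log_rpow (by linarith)]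
    have h2 : (1 + y) ^ s ≤ 1 + y ^ s := by
      simpa using Real.rpow_add_le_add_rpow zero_le_one hy0 hs0.le hs1
    have h3 := Real.log_le_sub_one_of_pos (x := (1 + y) ^ s) (by positivity)
    linarith
  have h2 : y ^ s ≤ N * t ^ p := by
    rw [hy, Real.mul_rpow (by positivity) (by positivity), ← Real.rpow_natCast t m,
      ← Real.rpow_mul ht]
    have : (m : ℝ) * s = p := by rw [hs]; field_simp
    rw [this]
    gcongr
    calc ((N : ℝ) / m) ^ s ≤ (N : ℝ) ^ s := by
          gcongr
          exact div_le_self (by positivity) hm0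
      _ ≤ (N : ℝ) ^ (1 : ℝ) := Real.rpow_le_rpow_of_exponent_le hN1 hs1
      _ = N := Real.rpow_one _
  unfold corrTerm
  rw [← hy, div_le_iff₀ (by linarith)]
  calc Real.log (1 + y) ≤ y ^ s / s := h1
    _ ≤ N * t ^ p / s := by gcongr
    _ = m / p * t ^ p * N := by rw [hs]; field_simp

open Filter Topology in
theorem tendsto_corrTerm (m : ℕ) {t : ℝ} (ht : 0 ≤ t) :
    Tendsto (fun N => corrTerm m N t) atTop (𝓝 0) := by
  set c := t ^ m / m with hc
  have hc0 : 0 ≤ c := by positivity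
  have h1 : Tendsto (fun N : ℕ => 2 * √(1 + c) * (√(N : ℝ) / N)) atTop (𝓝 0) := by
    have : Tendsto (fun N : ℕ => √(N : ℝ) / N) atTop (𝓝 0) := by
      have h : Tendsto (fun N : ℕ => (√(N : ℝ))⁻¹) atTop (𝓝 0) :=
        (Real.tendsto_sqrt_atTop.comp tendsto_natCast_atTop_atTop).inv_tendsto_atTop
      refine h.congr fun N => ?_
      rw [Real.sqrt_div_self', one_div]
    simpa using this.const_mul (2 * √(1 + c))
  refine squeeze_zero' (Eventually.of_forall fun N => corrTerm_nonneg m N ht) ?_ h1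
  filter_upwards [eventually_ge_atTop 1] with N hN
  have hN1 : (1 : ℝ) ≤ N := by exact_mod_cast hN
  unfold corrTerm
  rw [← mul_div_assoc]
  gcongr
  have h2 : 1 + N / m * t ^ m ≤ N * (1 + c) := by
    have : N / m * t ^ m = N * c := by rw [hc]; ring
    rw [this]; nlinarith
  have h0 : 0 < 1 + N / m * t ^ m := by positivity
  calc Real.log (1 + N / m * t ^ m) ≤ Real.log (N * (1 + c)) := Real.log_le_log h0 h2
    _ = 2 * Real.log (√(N * (1 + c))) := by rw [Real.log_sqrt (by positivity)]; ring
    _ ≤ 2 * √(N * (1 + c)) := by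
        gcongr
        exact Real.log_le_self (Real.sqrt_nonneg _)
    _ = 2 * √(1 + c) * √N := by rw [Real.sqrt_mul (by positivity)]; ring

theorem norm_modFactor_le {m N : ℕ} (hN : 1 ≤ N) {p Γ : ℝ}
    (hE : ∀ z : ℂ, ‖(1 - z) * Complex.exp (∑ j ∈ Finset.Icc 1 (m - 1), z ^ j / (j : ℂ))‖ ≤
      Real.exp (Γ * ‖z‖ ^ p)) (z : ℂ) :
    ‖modFactor m N z‖ ≤ Real.exp (N * (Γ * ‖z‖ ^ p + corrTerm m N ‖z‖)) := by
  have hN1 : (1 : ℝ) ≤ N := by exact_mod_cast hN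
  have h0 : 0 ≤ (N : ℝ) / m * ‖z‖ ^ m := by positivity
  unfold modFactor
  rw [norm_mul, norm_pow, mul_add, Real.exp_add]
  refine mul_le_mul ?_ ?_ (norm_nonneg _) (Real.exp_pos _).le
  · rw [Real.exp_nat_mul]
    exact pow_le_pow_left₀ (norm_nonneg _) (hE z) N
  · unfold corrTerm
    rw [mul_div_cancel₀ _ (by positivity), Real.exp_log (by linarith)]
    refine (norm_add_le _ _).trans ?_
    rw [norm_mul, norm_div, norm_pow]
    simp

open Metric in
/-- A form of Jensen's inequality: a weighted count of some of the zeros of an analytic function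
is at most the circle average of the logarithm of its modulus. -/
theorem AnalyticOnNhd.sum_mul_log_le_circleAverage {f : ℂ → ℂ} {ρ : ℝ} (hρ : 0 < ρ)
    (hf : AnalyticOnNhd ℂ f (closedBall 0 ρ)) (h0 : f 0 = 1) (S : Finset ℂ) (d : ℂ → ℕ)
    (hS : ∀ z ∈ S, ‖z‖ ≤ ρ) (hd : ∀ z ∈ S, (d z : ℕ∞) ≤ analyticOrderAt f z) :
    ∑ z ∈ S, d z * Real.log (ρ * ‖z‖⁻¹) ≤ Real.circleAverage (Real.log ‖f ·‖) 0 ρ := by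
  have hf' : AnalyticOnNhd ℂ f (closedBall 0 |ρ|) := by rwa [abs_of_pos hρ]
  rw [hf'.circleAverage_log_norm hρ.ne' (by simp [h0]), h0, norm_one, Real.log_one, add_zero]
  set D := MeromorphicOn.divisor f (closedBall 0 |ρ|) with hD
  have hfin := D.finiteSupport (isCompact_closedBall 0 |ρ|)
  have hDnn : ∀ u, 0 ≤ D u := fun u => MeromorphicOn.AnalyticOnNhd.divisor_nonneg hf' u
  have hnotmem : ∀ u, ¬ ‖u‖ ≤ ρ → D u = 0 := fun u hu => by
    apply Function.locallyFinsuppWithin.apply_eq_zero_of_notMem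
    simpa [abs_of_pos hρ] using hu
  have hsupp : (Function.support fun u => (D u : ℝ) * Real.log (ρ * ‖(0 : ℂ) - u‖⁻¹)) ⊆
      ((hfin.toFinset ∪ S : Finset ℂ) : Set ℂ) := by
    intro u hu
    simp only [Finset.coe_union, Set.Finite.coe_toFinset, Set.mem_union]
    left
    intro h
    simp [h] at hu
  have hlog : ∀ u : ℂ, ‖u‖ ≤ ρ → 0 ≤ Real.log (ρ * ‖u‖⁻¹) := fun u hu => by
    rcases eq_or_ne u 0 with rfl | h
    · simp
    · apply Real.log_nonneg
      rw [← div_eq_mul_inv, one_le_div (by positivity)]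
      exact hu
  rw [finsum_eq_sum_of_support_subset _ hsupp]
  simp only [zero_sub, norm_neg]
  calc ∑ z ∈ S, (d z : ℝ) * Real.log (ρ * ‖z‖⁻¹)
      ≤ ∑ z ∈ S, (D z : ℝ) * Real.log (ρ * ‖z‖⁻¹) := by
        refine Finset.sum_le_sum fun z hz => mul_le_mul_of_nonneg_right ?_ (hlog z (hS z hz))
        have hz' : z ∈ closedBall (0 : ℂ) |ρ| := by simpa [abs_of_pos hρ] using hS z hz
        have htop : analyticOrderAt f z ≠ ⊤ := by
          apply hf'.analyticOrderAt_ne_top_of_isPreconnected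
            (convex_closedBall (0 : ℂ) |ρ|).isPreconnected (x := 0) (by simp) hz'
          rw [(hf' 0 (by simp)).analyticOrderAt_eq_zero.mpr (by simp [h0])]
          simp
        rw [hD, MeromorphicOn.AnalyticOnNhd.divisor_apply hf' hz']
        have := hd z hz
        lift analyticOrderAt f z to ℕ using htop with k
        simp only [ENat.map_natCast]
        have h2 : d z ≤ k := by exact_mod_cast this
        rw [WithTop.untop₀_coe]
        exact_mod_cast h2
    _ ≤ ∑ z ∈ hfin.toFinset ∪ S, (D z : ℝ) * Real.log (ρ * ‖z‖⁻¹) := by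
        refine Finset.sum_le_sum_of_subset_of_nonneg Finset.subset_union_right fun u _ _ => ?_
        by_cases hu : ‖u‖ ≤ ρ
        · exact mul_nonneg (by exact_mod_cast hDnn u) (hlog u hu)
        · simp [hnotmem u hu]

section OrderOfVanishing

open Filter Topology

theorem AnalyticAt.matrix_det {n : Type*} [Fintype n] [DecidableEq n] {M : ℂ → Matrix n n ℂ}
    {w : ℂ} (hM : ∀ i j, AnalyticAt ℂ (fun w => M w i j) w) :
    AnalyticAt ℂ (fun w => (M w).det) w := by
  simp only [Matrix.det_apply]
  refine Finset.analyticAt_fun_sum _ fun σ _ => ?_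
  simp only [Units.smul_def, zsmul_eq_mul]
  exact analyticAt_const.mul (Finset.analyticAt_fun_prod _ fun i _ => hM _ _)

theorem Module.Basis.sumExtend_inl {ι K V : Type*} [DivisionRing K] [AddCommGroup V] [Module K V]
    {v : ι → V} (hs : LinearIndependent K v) (i : ι) : Basis.sumExtend hs (Sum.inl i) = v i := by
  simp only [Basis.sumExtend, Basis.coe_reindex, Function.comp_apply, Basis.extend_apply_self]
  rfl

variable {V W : Type*} [AddCommGroup V] [Module ℂ V] [FiniteDimensional ℂ V]
  [AddCommGroup W] [Module ℂ W] [FiniteDimensional ℂ W]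

theorem det_one_sub_smul_of_maxGenEigenspace_eq_top {T : Module.End ℂ V} {μ : ℂ}
    (hT : T.maxGenEigenspace μ = ⊤) {w : ℂ} (hw : w ≠ 0) :
    LinearMap.det (1 - w • T) = (1 - w * μ) ^ Module.finrank ℂ V := by
  have hnil : IsNilpotent (T - μ • (1 : Module.End ℂ V)) := by
    refine ⟨Module.finrank ℂ V, LinearMap.ext fun x => ?_⟩
    have hx : x ∈ T.maxGenEigenspace μ := hT ▸ Submodule.mem_top
    rw [Module.End.maxGenEigenspace_eq_genEigenspace_finrank, Module.End.mem_genEigenspace_nat]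
      at hx
    exact hx
  have h1 := hnil.charpoly_eq_X_pow_finrank
  have h2 : 1 - w • T = w • (algebraMap ℂ (Module.End ℂ V) (w⁻¹ - μ) -
      (T - μ • (1 : Module.End ℂ V))) := by
    rw [Algebra.algebraMap_eq_smul_one, sub_smul, sub_sub_sub_cancel_right, smul_sub, smul_smul,
      mul_inv_cancel₀ hw, one_smul]
  rw [h2, LinearMap.det_smul, ← LinearMap.eval_charpoly, h1, Polynomial.eval_pow,
    Polynomial.eval_X, ← mul_pow, mul_sub, mul_inv_cancel₀ hw]

theorem finrank_le_analyticOrderAt_det {D : ℂ → W →ₗ[ℂ] W} {J : ℂ → V →ₗ[ℂ] W} {ι : V →ₗ[ℂ] W}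
    (hι : Function.Injective ι) {T : Module.End ℂ V} {μ w₀ : ℂ} (hT : T.maxGenEigenspace μ = ⊤)
    (hw : w₀ * μ = 1) (hJ : Function.Injective (J w₀))
    (hDa : ∀ x (l : W →ₗ[ℂ] ℂ), AnalyticAt ℂ (fun w => l (D w x)) w₀)
    (hJa : ∀ v (l : W →ₗ[ℂ] ℂ), AnalyticAt ℂ (fun w => l (J w v)) w₀)
    (hDJ : ∀ᶠ w in 𝓝 w₀, ∀ v, D w (J w v) = ι ((1 - w • T) v)) :
    (Module.finrank ℂ V : ℕ∞) ≤ analyticOrderAt (fun w => LinearMap.det (D w)) w₀ := by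
  classical
  have hw0 : w₀ ≠ 0 := left_ne_zero_of_mul_eq_one hw
  set d := Module.finrank ℂ V with hd
  let b : Module.Basis (Fin d) ℂ V := Module.finBasis ℂ V
  have hli : LinearIndependent ℂ (ι ∘ b) :=
    b.linearIndependent.map' ι (LinearMap.ker_eq_bot.mpr hι)
  have hli' : LinearIndependent ℂ (J w₀ ∘ b) :=
    b.linearIndependent.map' (J w₀) (LinearMap.ker_eq_bot.mpr hJ)
  let x₀ := Module.Basis.sumExtend hli
  let y₀ := Module.Basis.sumExtend hli'
  have : Finite (Fin d ⊕ Module.Basis.sumExtendIndex hli) := Module.Finite.finite_basis x₀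
  have : Finite (Fin d ⊕ Module.Basis.sumExtendIndex hli') := Module.Finite.finite_basis y₀
  have : Finite (Module.Basis.sumExtendIndex hli) := Finite.sum_right (Fin d)
  have : Finite (Module.Basis.sumExtendIndex hli') := Finite.sum_right (Fin d)
  have := Fintype.ofFinite (Module.Basis.sumExtendIndex hli)
  have := Fintype.ofFinite (Module.Basis.sumExtendIndex hli')
  have hcard : Fintype.card (Module.Basis.sumExtendIndex hli) =
      Fintype.card (Module.Basis.sumExtendIndex hli') := by
    have h1 := Module.finrank_eq_card_basis x₀
    have h2 := Module.finrank_eq_card_basis y₀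
    rw [Fintype.card_sum] at h1 h2
    omega
  let e := Fintype.equivOfCardEq hcard
  let κ := Module.Basis.sumExtendIndex hli
  let y := y₀.reindex ((Equiv.refl (Fin d)).sumCongr e.symm)
  have hx : ∀ i, x₀ (Sum.inl i) = ι (b i) := fun i =>
    Module.Basis.sumExtend_inl hli i
  have hy : ∀ i, y (Sum.inl i) = J w₀ (b i) := fun i => by
    simp [y, y₀, Module.Basis.sumExtend_inl]
  let c : ℂ → (Fin d ⊕ κ) → W := fun w => Sum.elim (fun i => J w (b i)) fun k => y (Sum.inr k)
  have hc0 : c w₀ = y := by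
    ext (i | k)
    · exact (hy i).symm
    · rfl
  have hdet : ∀ᶠ w in 𝓝 w₀, LinearMap.det (D w) * x₀.det (c w) =
      (1 - w * μ) ^ d *
        (Matrix.of fun k l : κ => x₀.repr (D w (y (Sum.inr l))) (Sum.inr k)).det := by
    filter_upwards [hDJ, isOpen_ne.mem_nhds hw0] with w hDJw hwne
    rw [← Module.Basis.det_comp, Module.Basis.det_apply,
      ← det_one_sub_smul_of_maxGenEigenspace_eq_top hT hwne,
      ← LinearMap.det_toMatrix b, ← Matrix.fromBlocks_toBlocks (x₀.toMatrix (D w ∘ c w))]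
    have h21 : (x₀.toMatrix (D w ∘ c w)).toBlocks₂₁ = 0 := by
      ext k i
      show x₀.repr (D w (J w (b i))) (Sum.inr k) = 0
      rw [hDJw, ← b.sum_repr ((1 - w • T) (b i))]
      simp only [map_sum, map_smul, ← hx, Module.Basis.repr_self]
      simp
    have h11 : (x₀.toMatrix (D w ∘ c w)).toBlocks₁₁ = LinearMap.toMatrix b b (1 - w • T) := by
      ext k i
      show x₀.repr (D w (J w (b i))) (Sum.inl k) = _
      rw [hDJw, LinearMap.toMatrix_apply]
      conv_lhs => rw [← b.sum_repr ((1 - w • T) (b i))]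
      simp only [map_sum, map_smul, ← hx, Module.Basis.repr_self]
      simp [Finsupp.single_apply]
    rw [h21, Matrix.det_fromBlocks_zero₂₁, h11]
    rfl
  have hea : AnalyticAt ℂ (fun w => x₀.det (c w)) w₀ := by
    simp only [Module.Basis.det_apply]
    refine AnalyticAt.matrix_det fun i j => ?_
    rcases j with j | k
    · exact hJa (b j) (x₀.coord i)
    · exact (analyticAt_const : AnalyticAt ℂ (fun _ => x₀.repr (y (Sum.inr k)) i) w₀)
  have hda : AnalyticAt ℂ (fun w => LinearMap.det (D w)) w₀ := by
    simp only [← LinearMap.det_toMatrix x₀]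
    refine AnalyticAt.matrix_det fun i j => ?_
    simp only [LinearMap.toMatrix_apply]
    exact hDa (x₀ j) (x₀.coord i)
  have hSa : AnalyticAt ℂ (fun w =>
      (Matrix.of fun k l : κ => x₀.repr (D w (y (Sum.inr l))) (Sum.inr k)).det) w₀ :=
    AnalyticAt.matrix_det fun k l => hDa (y (Sum.inr l)) (x₀.coord (Sum.inr k))
  have he0 : x₀.det (c w₀) ≠ 0 := by
    rw [hc0]
    exact (x₀.isUnit_det y).ne_zero
  have h1a : AnalyticAt ℂ (fun w : ℂ => 1 - w * μ) w₀ := by fun_prop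
  have h1 : 1 ≤ analyticOrderAt (fun w : ℂ => 1 - w * μ) w₀ := by
    rw [Order.one_le_iff_ne_zero]
    intro h
    rw [h1a.analyticOrderAt_eq_zero, hw, sub_self] at h
    exact h rfl
  have h2 := analyticOrderAt_congr hdet
  have h3 := analyticOrderAt_mul hda hea
  have h4 := analyticOrderAt_mul (h1a.pow d) hSa
  rw [hea.analyticOrderAt_eq_zero.mpr he0, add_zero] at h3
  rw [analyticOrderAt_pow h1a] at h4
  rw [← h3]
  refine le_trans ?_ ((le_of_eq h4.symm).trans (le_of_eq h2.symm))
  calc (d : ℕ∞) = d • 1 := by simp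
    _ ≤ d • analyticOrderAt (fun w : ℂ => 1 - w * μ) w₀ := nsmul_le_nsmul_right h1 d
    _ ≤ _ := le_self_add

end OrderOfVanishing

section ReverseFatou

open MeasureTheory Filter Topology

theorem le_of_le_integral_of_eventually_le {α : Type*} [MeasurableSpace α] {μ : Measure α}
    [IsFiniteMeasure μ] (hμ : μ ≠ 0) {u : ℕ → ℕ → α → ℝ} {c β S : ℝ}
    (hm : ∀ N n, Measurable (u N n)) (hi : ∀ N n, Integrable (u N n) μ)
    (hc : ∀ N n x, u N n x ≤ c)
    (hu : ∀ x, ∀ δ > 0, ∃ N₀, ∀ N ≥ N₀, ∀ᶠ n in atTop, u N n x ≤ β + δ)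
    (hS : ∀ N n, S * μ.real Set.univ ≤ ∫ x, u N n x ∂μ) : S ≤ β := by
  set f : ℕ → ℕ → α → ENNReal := fun N n x => ENNReal.ofReal (u N n x - β) with hf
  have hfm : ∀ N n, Measurable (f N n) := fun N n => ((hm N n).sub_const β).ennreal_ofReal
  have hfc : ∀ N n x, f N n x ≤ ENNReal.ofReal (c - β) := fun N n x =>
    ENNReal.ofReal_le_ofReal (by linarith [hc N n x])
  have hfin : ∫⁻ _, ENNReal.ofReal (c - β) ∂μ ≠ ⊤ := by
    rw [lintegral_const]
    exact ENNReal.mul_ne_top ENNReal.ofReal_ne_top (measure_ne_top μ _)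
  have h1 : ∀ N n, ENNReal.ofReal ((S - β) * μ.real Set.univ) ≤ ∫⁻ x, f N n x ∂μ := by
    intro N n
    have hi' : Integrable (fun x => u N n x - β) μ := (hi N n).sub (integrable_const β)
    have h2 : (S - β) * μ.real Set.univ ≤ ∫ x, (u N n x - β) ∂μ := by
      rw [integral_sub (hi N n) (integrable_const β), integral_const, smul_eq_mul]
      linarith [hS N n]
    refine ENNReal.ofReal_le_of_le_toReal (h2.trans ?_)
    rw [integral_eq_lintegral_pos_part_sub_lintegral_neg_part hi']
    exact sub_le_self _ ENNReal.toReal_nonneg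
  have h2 : ∀ N, ENNReal.ofReal ((S - β) * μ.real Set.univ) ≤
      ∫⁻ x, limsup (fun n => f N n x) atTop ∂μ := by
    intro N
    refine le_trans ?_ (limsup_lintegral_le (μ := μ) (f := f N)
      (fun _ => ENNReal.ofReal (c - β)) (hfm N) (fun n => Eventually.of_forall (hfc N n)) hfin)
    exact (limsup_const (f := atTop (α := ℕ)) _).symm.le.trans
      (limsup_le_limsup (Eventually.of_forall (h1 N)))
  have h3 : ∀ x, Tendsto (fun N => limsup (fun n => f N n x) atTop) atTop (𝓝 0) := by
    intro x
    rw [ENNReal.tendsto_nhds_zero]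
    intro δ hδ
    obtain ⟨η, hη0, hηδ⟩ : ∃ η : ℝ, 0 < η ∧ ENNReal.ofReal η ≤ δ := by
      by_cases hδt : δ = ⊤
      · exact ⟨1, one_pos, hδt ▸ le_top⟩
      · exact ⟨δ.toReal, ENNReal.toReal_pos hδ.ne' hδt, ENNReal.ofReal_toReal_le⟩
    obtain ⟨N₀, hN₀⟩ := hu x η hη0
    filter_upwards [eventually_ge_atTop N₀] with N hN
    refine (limsup_le_of_le (h := ?_)).trans hηδ
    filter_upwards [hN₀ N hN] with n hn
    exact ENNReal.ofReal_le_ofReal (by linarith)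
  have h4 : Tendsto (fun N => ∫⁻ x, limsup (fun n => f N n x) atTop ∂μ) atTop (𝓝 0) := by
    have := tendsto_lintegral_of_dominated_convergence (μ := μ) (f := fun _ => 0)
      (F := fun N x => limsup (fun n => f N n x) atTop)
      (fun _ => ENNReal.ofReal (c - β)) (fun N => Measurable.limsup (hfm N))
      (fun N => Eventually.of_forall fun x =>
        limsup_le_of_le (h := Eventually.of_forall fun n => hfc N n x)) hfin
      (Eventually.of_forall h3)
    simpa using this
  have h5 := le_of_tendsto_of_tendsto' tendsto_const_nhds h4 h2
  have h6 : (S - β) * μ.real Set.univ ≤ 0 := by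
    rwa [nonpos_iff_eq_zero, ENNReal.ofReal_eq_zero] at h5
  have h7 : 0 < μ.real Set.univ := by
    rw [Measure.real, ENNReal.toReal_pos_iff]
    exact ⟨by simpa [pos_iff_ne_zero] using hμ, measure_lt_top μ _⟩
  nlinarith

end ReverseFatou

section ResolventMoment

open Metric

variable {𝔸 : Type*} [NormedRing 𝔸] [NormedAlgebra ℂ 𝔸]

/-- The moment `(2πi)⁻¹ ∮ (z - ν)ⁿ (z - a)⁻¹ dz` of the resolvent over the circle `|z - μ| = r`. -/
noncomputable def resolventMoment (a : 𝔸) (μ : ℂ) (r : ℝ) (ν : ℂ) (n : ℤ) : 𝔸 :=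
  (2 * Real.pi * Complex.I : ℂ)⁻¹ • ∮ z in C(μ, r), (z - ν) ^ n • resolvent a z

theorem resolvent_mul_sub {a : 𝔸} {z : ℂ} (hz : z ∈ resolventSet ℂ a) :
    resolvent a z * (algebraMap ℂ 𝔸 z - a) = 1 :=
  Ring.inverse_mul_cancel _ hz

theorem sub_mul_resolvent {a : 𝔸} {z : ℂ} (hz : z ∈ resolventSet ℂ a) :
    (algebraMap ℂ 𝔸 z - a) * resolvent a z = 1 :=
  Ring.mul_inverse_cancel _ hz

theorem norm_resolventMoment_le {a : 𝔸} {μ : ℂ} {r M : ℝ} (hr : 0 < r)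
    (hM : ∀ z ∈ sphere μ r, ‖resolvent a z‖ ≤ M) (n : ℤ) :
    ‖resolventMoment a μ r μ n‖ ≤ r * (r ^ n * M) := by
  refine circleIntegral.norm_two_pi_i_inv_smul_integral_le_of_norm_le_const hr.le fun z hz => ?_
  rw [norm_smul, norm_zpow, mem_sphere_iff_norm.mp hz]
  exact mul_le_mul_of_nonneg_left (hM z hz) (by positivity)

variable [CompleteSpace 𝔸]

theorem differentiableAt_resolvent {a : 𝔸} {z : ℂ} (hz : z ∈ resolventSet ℂ a) :
    DifferentiableAt ℂ (resolvent a) z :=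
  (spectrum.hasDerivAt_resolvent_const_left hz).differentiableAt

theorem continuousOn_zpow_smul_resolvent {a : 𝔸} {ν : ℂ} {s : Set ℂ}
    (hs : s ⊆ resolventSet ℂ a) (hν : ν ∉ s) (n : ℤ) :
    ContinuousOn (fun z => (z - ν) ^ n • resolvent a z) s := fun z hz =>
  (((continuousAt_id.sub continuousAt_const).zpow₀ n
    (Or.inl (sub_ne_zero.mpr fun h : z = ν => hν (h ▸ hz)))).smul
      (differentiableAt_resolvent (hs hz)).continuousAt).continuousWithinAt

theorem ContinuousLinearMap.circleIntegral_comp_comm {E F : Type*} [NormedAddCommGroup E]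
    [NormedSpace ℂ E] [CompleteSpace E] [NormedAddCommGroup F] [NormedSpace ℂ F]
    [CompleteSpace F] (L : E →L[ℂ] F) {f : ℂ → E} {c : ℂ} {r : ℝ} (hf : CircleIntegrable f c r) :
    L (∮ z in C(c, r), f z) = ∮ z in C(c, r), L (f z) := by
  simp only [circleIntegral, ← map_smul]
  exact (L.intervalIntegral_comp_comm hf.out).symm

theorem commute_resolventMoment {a : 𝔸} {μ ν : ℂ} {r : ℝ} (hr : 0 < r)
    (hs : sphere μ r ⊆ resolventSet ℂ a) (hν : ν ∉ sphere μ r) (n : ℤ) :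
    Commute a (resolventMoment a μ r ν n) := by
  have hint := (continuousOn_zpow_smul_resolvent hs hν n).circleIntegrable hr.le
  have h1 := (ContinuousLinearMap.mul ℂ 𝔸 a).circleIntegral_comp_comm hint
  have h2 := ((ContinuousLinearMap.mul ℂ 𝔸).flip a).circleIntegral_comp_comm hint
  simp only [ContinuousLinearMap.flip_apply, ContinuousLinearMap.mul_apply'] at h1 h2
  rw [Commute, SemiconjBy, resolventMoment, mul_smul_comm, smul_mul_assoc, h1, h2]
  congr 1
  refine circleIntegral.integral_congr hr.le fun z hz => ?_
  have hc : Commute a (resolvent a z) := by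
    obtain ⟨u, hu⟩ := hs hz
    have hua : Commute a (u : 𝔸) := by
      rw [hu]
      exact Commute.sub_right (Algebra.commutes z a).symm (Commute.refl a)
    rw [resolvent, ← hu, Ring.inverse_unit]
    exact hua.units_inv_right
  simp only [mul_smul_comm, smul_mul_assoc, hc.eq]

theorem sub_mul_resolventMoment {a : 𝔸} {μ ν : ℂ} {r : ℝ} (hr : 0 < r)
    (hs : sphere μ r ⊆ resolventSet ℂ a) (hν : ν ∉ sphere μ r) (n : ℤ) :
    (a - algebraMap ℂ 𝔸 ν) * resolventMoment a μ r ν n =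
      resolventMoment a μ r ν (n + 1) -
        ((2 * Real.pi * Complex.I : ℂ)⁻¹ * ∮ z in C(μ, r), (z - ν) ^ n) • 1 := by
  have hint := (continuousOn_zpow_smul_resolvent hs hν n).circleIntegrable hr.le
  have hint' := (continuousOn_zpow_smul_resolvent hs hν (n + 1)).circleIntegrable hr.le
  have hne : ∀ z ∈ sphere μ r, z - ν ≠ 0 := fun z hz => sub_ne_zero.mpr fun h => hν (h ▸ hz)
  have hint0 : CircleIntegrable (fun z => (z - ν) ^ n • (1 : 𝔸)) μ r := by
    apply ContinuousOn.circleIntegrable hr.le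
    exact fun z hz => (((continuousAt_id.sub continuousAt_const).zpow₀ n
      (Or.inl (hne z hz))).smul continuousAt_const).continuousWithinAt
  have h1 := (ContinuousLinearMap.mul ℂ 𝔸 (a - algebraMap ℂ 𝔸 ν)).circleIntegral_comp_comm hint
  simp only [ContinuousLinearMap.mul_apply'] at h1
  rw [resolventMoment, resolventMoment, mul_smul_comm, h1, mul_smul,
    ← circleIntegral.integral_smul_const, ← smul_sub, ← circleIntegral.integral_sub hint' hint0]
  congr 1
  refine circleIntegral.integral_congr hr.le fun z hz => ?_
  have key : (a - algebraMap ℂ 𝔸 ν) * resolvent a z = (z - ν) • resolvent a z - 1 := by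
    rw [← sub_mul_resolvent (hs hz), Algebra.smul_def, map_sub]
    noncomm_ring
  simp only [mul_smul_comm, key, smul_sub, smul_smul, zpow_add_one₀ (hne z hz)]

theorem two_pi_I_inv_mul_circleIntegral_zpow {μ ν : ℂ} {r : ℝ} (hν : ν ∈ ball μ r) (n : ℤ) :
    (2 * Real.pi * Complex.I : ℂ)⁻¹ * ∮ z in C(μ, r), (z - ν) ^ n = if n = -1 then 1 else 0 := by
  split_ifs with h
  · subst h
    simp only [zpow_neg_one, circleIntegral.integral_sub_inv_of_mem_ball hν]
    exact inv_mul_cancel₀ Complex.two_pi_I_ne_zero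
  · rw [circleIntegral.integral_sub_zpow_of_ne h, mul_zero]

theorem notMem_sphere_of_mem_ball {μ ν : ℂ} {r : ℝ} (hν : ν ∈ ball μ r) : ν ∉ sphere μ r :=
  fun h => (mem_ball.mp hν).ne (mem_sphere.mp h)

theorem sub_mul_resolventMoment_of_mem_ball {a : 𝔸} {μ ν : ℂ} {r : ℝ} 
    (hs : sphere μ r ⊆ resolventSet ℂ a) (hν : ν ∈ ball μ r) (n : ℤ) :
    (a - algebraMap ℂ 𝔸 ν) * resolventMoment a μ r ν n =
      resolventMoment a μ r ν (n + 1) - if n = -1 then 1 else 0 := by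
  rw [sub_mul_resolventMoment (pos_of_mem_ball hν) hs (notMem_sphere_of_mem_ball hν),
    two_pi_I_inv_mul_circleIntegral_zpow hν]
  split_ifs <;> simp

theorem sub_pow_mul_resolventMoment_zero {a : 𝔸} {μ ν : ℂ} {r : ℝ}
    (hs : sphere μ r ⊆ resolventSet ℂ a) (hν : ν ∈ ball μ r) (k : ℕ) :
    (a - algebraMap ℂ 𝔸 ν) ^ k * resolventMoment a μ r ν 0 = resolventMoment a μ r ν k := by
  induction k with
  | zero => simp
  | succ k ih =>
    rw [pow_succ', mul_assoc, ih, sub_mul_resolventMoment_of_mem_ball hs hν, if_neg (by lia)]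
    simp

theorem sub_pow_mul_resolventMoment_neg {a : 𝔸} {μ ν : ℂ} {r : ℝ} 
    (hs : sphere μ r ⊆ resolventSet ℂ a) (hν : ν ∈ ball μ r) (k : ℕ) :
    (a - algebraMap ℂ 𝔸 ν) ^ (k + 1) * resolventMoment a μ r ν (-(k + 1 : ℕ)) =
      resolventMoment a μ r ν 0 - 1 := by
  induction k with
  | zero => simpa using sub_mul_resolventMoment_of_mem_ball hs hν (-1)
  | succ k ih =>
    rw [pow_succ, mul_assoc, sub_mul_resolventMoment_of_mem_ball hs hν, if_neg (by push_cast; lia),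
      sub_zero, ← ih]
    congr 2

theorem exists_norm_resolvent_le {a : 𝔸} {s : Set ℂ} (hs : IsCompact s)
    (h : s ⊆ resolventSet ℂ a) : ∃ M : ℝ, 0 < M ∧ ∀ z ∈ s, ‖resolvent a z‖ ≤ M := by
  obtain ⟨M, hM⟩ := hs.exists_bound_of_continuousOn (f := resolvent a) fun z hz =>
    (differentiableAt_resolvent (h hz)).continuousAt.continuousWithinAt
  exact ⟨max M 1, by positivity, fun z hz => (hM z hz).trans (le_max_left _ _)⟩

theorem resolventMoment_eq_of_le {a : 𝔸} {μ : ℂ} {r r' : ℝ} (hr : 0 < r) (hrr' : r ≤ r')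
    (h : closedBall μ r' \ {μ} ⊆ resolventSet ℂ a) (n : ℤ) :
    resolventMoment a μ r' μ n = resolventMoment a μ r μ n := by
  rw [resolventMoment, resolventMoment]
  congr 1
  refine Complex.circleIntegral_eq_of_differentiable_on_annulus_off_countable hr hrr'
    Set.countable_empty ?_ ?_
  · refine continuousOn_zpow_smul_resolvent (fun z hz => h ⟨hz.1, ?_⟩) ?_ n
    · rintro rfl
      exact hz.2 (mem_ball_self hr)
    · exact fun hz => hz.2 (mem_ball_self hr)
  · rintro z ⟨⟨hz1, hz2⟩, -⟩
    have hne : z ≠ μ := by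
      rintro rfl
      exact hz2 (mem_closedBall_self hr.le)
    exact ((differentiableAt_id.sub_const μ).zpow (Or.inl (sub_ne_zero.mpr hne))).smul
      (differentiableAt_resolvent (h ⟨ball_subset_closedBall hz1, hne⟩))

theorem sphere_subset_of_punctured {μ : ℂ} {r : ℝ} (hr : 0 < r) {s : Set ℂ}
    (h : closedBall μ r \ {μ} ⊆ s) : sphere μ r ⊆ s := fun z hz =>
  h ⟨sphere_subset_closedBall hz, by rintro rfl; simp [hr.ne] at hz⟩

theorem isIdempotentElem_resolventMoment {a : 𝔸} {μ : ℂ} {r : ℝ} (hr : 0 < r)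
    (h : closedBall μ r \ {μ} ⊆ resolventSet ℂ a) :
    IsIdempotentElem (resolventMoment a μ r μ 0) := by
  have hr2 : 0 < r / 2 := by positivity
  have h' : closedBall μ (r / 2) \ {μ} ⊆ resolventSet ℂ a := fun z hz =>
    h ⟨closedBall_subset_closedBall (by linarith) hz.1, hz.2⟩
  have hs := sphere_subset_of_punctured hr h
  have hs' := sphere_subset_of_punctured hr2 h'
  set P := resolventMoment a μ r μ 0 with hP
  have hPP : P = resolventMoment a μ (r / 2) μ 0 :=
    resolventMoment_eq_of_le hr2 (by linarith) h 0
  obtain ⟨M, hM0, hM⟩ := exists_norm_resolvent_le (isCompact_sphere μ r) hs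
  obtain ⟨M', hM0', hM'⟩ := exists_norm_resolvent_le (isCompact_sphere μ (r / 2)) hs'
  have hprod : ∀ k : ℕ, P * (P - 1) =
      resolventMoment a μ (r / 2) μ (k + 1 : ℕ) * resolventMoment a μ r μ (-(k + 1 : ℕ)) := by
    intro k
    have hc : Commute (a - algebraMap ℂ 𝔸 μ) P :=
      (commute_resolventMoment hr hs (notMem_sphere_of_mem_ball (mem_ball_self hr)) 0).sub_left
        (Algebra.commutes μ P)
    rw [← sub_pow_mul_resolventMoment_zero hs' (mem_ball_self hr2) (k + 1), ← hPP,
      (hc.pow_left (k + 1)).eq, mul_assoc,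
      sub_pow_mul_resolventMoment_neg hs (mem_ball_self hr) k]
  have hbound : ∀ k : ℕ, ‖P * (P - 1)‖ ≤ (r / 2 * M') * (r * M) * (1 / 2) ^ (k + 1) := by
    intro k
    rw [hprod k]
    refine (norm_mul_le _ _).trans ((mul_le_mul (norm_resolventMoment_le hr2 hM' _)
      (norm_resolventMoment_le hr hM _) (norm_nonneg _) (by positivity)).trans_eq ?_)
    rw [zpow_natCast, zpow_neg, zpow_natCast, div_pow, one_div_pow]
    field_simp
  have hlim : Filter.Tendsto (fun k : ℕ => (r / 2 * M') * (r * M) * (1 / 2 : ℝ) ^ (k + 1))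
      Filter.atTop (nhds 0) := by
    have := (tendsto_pow_atTop_nhds_zero_of_lt_one (r := (1 / 2 : ℝ)) (by norm_num)
      (by norm_num)).comp (Filter.tendsto_add_atTop_nat 1)
    simpa using this.const_mul ((r / 2 * M') * (r * M))
  have h0 : P * (P - 1) = 0 :=
    norm_le_zero_iff.mp (ge_of_tendsto' hlim hbound)
  rw [mul_sub, mul_one, sub_eq_zero] at h0
  exact h0

theorem eventually_norm_resolvent_sub_le (a : 𝔸) {s : Set ℂ} (hs : IsCompact s)
    (h : s ⊆ resolventSet ℂ a) {η : ℝ} (hη : 0 < η) :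
    ∀ᶠ b in nhds a, s ⊆ resolventSet ℂ b ∧ ∀ z ∈ s, ‖resolvent b z - resolvent a z‖ ≤ η := by
  obtain ⟨M, hM0, hM⟩ := exists_norm_resolvent_le hs h
  filter_upwards [ball_mem_nhds a (show 0 < min (1 / (2 * M)) (η / (2 * M ^ 2)) by positivity)]
    with b hb
  rw [mem_ball, dist_eq_norm, lt_min_iff] at hb
  obtain ⟨hb1, hb2⟩ := hb
  have hunit : s ⊆ resolventSet ℂ b := by
    intro z hz
    have hlt : ‖resolvent a z * (b - a)‖ < 1 := by
      refine (norm_mul_le _ _).trans_lt ?_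
      calc ‖resolvent a z‖ * ‖b - a‖ ≤ M * (1 / (2 * M)) := by
            gcongr
            exact hM z hz
        _ < 1 := by field_simp; norm_num
    have heq : algebraMap ℂ 𝔸 z - b =
        (algebraMap ℂ 𝔸 z - a) * (1 - resolvent a z * (b - a)) := by
      rw [mul_sub, ← mul_assoc, sub_mul_resolvent (h hz)]
      noncomm_ring
    rw [spectrum.mem_resolventSet_iff, heq]
    exact (h hz).mul (isUnit_one_sub_of_norm_lt_one hlt)
  refine ⟨hunit, fun z hz => ?_⟩
  have hid : resolvent b z - resolvent a z = resolvent b z * (b - a) * resolvent a z := by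
    calc resolvent b z - resolvent a z
        = resolvent b z * ((algebraMap ℂ 𝔸 z - a) * resolvent a z) -
          (resolvent b z * (algebraMap ℂ 𝔸 z - b)) * resolvent a z := by
          rw [sub_mul_resolvent (h hz), resolvent_mul_sub (hunit hz), mul_one, one_mul]
      _ = _ := by noncomm_ring
  have hle : ‖resolvent b z - resolvent a z‖ ≤ ‖resolvent b z‖ * ‖b - a‖ * M := by
    rw [hid]
    refine (norm_mul_le _ _).trans (mul_le_mul (norm_mul_le _ _) (hM z hz) (norm_nonneg _)
      (by positivity))
  have hb2M : ‖resolvent b z‖ ≤ 2 * M := by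
    have h1 : ‖resolvent b z‖ ≤ M + ‖resolvent b z‖ * ‖b - a‖ * M := by
      have := norm_le_norm_add_norm_sub' (resolvent b z) (resolvent a z)
      have := hM z hz
      linarith
    have h2 : ‖b - a‖ * M ≤ 1 / 2 := by
      calc ‖b - a‖ * M ≤ 1 / (2 * M) * M := by gcongr
        _ = 1 / 2 := by field_simp
    nlinarith [norm_nonneg (resolvent b z)]
  calc ‖resolvent b z - resolvent a z‖ ≤ ‖resolvent b z‖ * ‖b - a‖ * M := hle
    _ ≤ 2 * M * (η / (2 * M ^ 2)) * M := by gcongr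
    _ = η := by field_simp

theorem tendsto_resolventMoment_zero (a : 𝔸) {μ : ℂ} {r : ℝ} (hr : 0 < r)
    (h : sphere μ r ⊆ resolventSet ℂ a) :
    Filter.Tendsto (fun b => resolventMoment b μ r μ 0) (nhds a)
      (nhds (resolventMoment a μ r μ 0)) := by
  rw [Metric.tendsto_nhds]
  intro η hη
  filter_upwards [eventually_norm_resolvent_sub_le a (isCompact_sphere μ r) h
    (show 0 < η / (2 * r) by positivity)] with b ⟨hb, hb'⟩
  have hμ := notMem_sphere_of_mem_ball (mem_ball_self (x := μ) hr)
  have hint := (continuousOn_zpow_smul_resolvent h hμ 0).circleIntegrable hr.le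
  have hint' := (continuousOn_zpow_smul_resolvent hb hμ 0).circleIntegrable hr.le
  rw [dist_eq_norm, resolventMoment, resolventMoment, ← smul_sub,
    ← circleIntegral.integral_sub hint' hint]
  calc _ ≤ r * (η / (2 * r)) := by
        refine circleIntegral.norm_two_pi_i_inv_smul_integral_le_of_norm_le_const hr.le ?_
        intro z hz
        simpa using hb' z hz
    _ < η := by
        field_simp
        linarith

end ResolventMoment

section RieszProjection

open Metric

theorem rieszProjection_eq_resolventMoment (T : X →L[ℂ] X) (μ ν : ℂ) (r : ℝ) :
    rieszProjection T μ r = resolventMoment T μ r ν 0 := by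
  simp [rieszProjection, resolventMoment]

theorem circleIntegral_sub_zpow_eq_zero {μ ν : ℂ} {r : ℝ} (hr : 0 ≤ r) (hν : ν ∉ closedBall μ r)
    (n : ℤ) : ∮ z in C(μ, r), (z - ν) ^ n = 0 := by
  have hne : ∀ z ∈ closedBall μ r, z - ν ≠ 0 := fun z hz => sub_ne_zero.mpr fun h => hν (h ▸ hz)
  refine Complex.circleIntegral_eq_zero_of_differentiable_on_off_countable hr
    Set.countable_empty (fun z hz => ?_) fun z hz => ?_
  · exact ((continuousAt_id.sub continuousAt_const).zpow₀ n
      (Or.inl (hne z hz))).continuousWithinAt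
  · exact (differentiableAt_id.sub_const ν).zpow (Or.inl (hne z (ball_subset_closedBall hz.1)))

theorem rieszProjection_apply_of_sub_pow_eq_zero {T : X →L[ℂ] X} {μ ν : ℂ} {r : ℝ}
    (hs : sphere μ r ⊆ resolventSet ℂ T) (hν : ν ∈ ball μ r) {k : ℕ} {v : X}
    (hv : ((T - algebraMap ℂ (X →L[ℂ] X) ν) ^ k) v = 0) : rieszProjection T μ r v = v := by
  set N := T - algebraMap ℂ (X →L[ℂ] X) ν with hN
  have hrec : ∀ (n : ℤ) (x : X), resolventMoment T μ r ν n (N x) =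
      resolventMoment T μ r ν (n + 1) x - if n = -1 then x else 0 := by
    intro n x
    have hc : Commute N (resolventMoment T μ r ν n) :=
      (commute_resolventMoment (pos_of_mem_ball hν) hs
        (notMem_sphere_of_mem_ball hν) n).sub_left (Algebra.commutes ν _)
    have := congrArg (fun S : X →L[ℂ] X => S x)
      (sub_mul_resolventMoment_of_mem_ball hs hν n)
    rw [← hN, hc.eq] at this
    simp only [mul_apply_eq_comp, sub_apply] at this
    rw [this]
    split_ifs <;> simp
  have key : ∀ (k : ℕ) (x : X), (N ^ k) x = 0 → ∀ n : ℤ, n ≤ -1 →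
      resolventMoment T μ r ν n x = 0 := by
    intro k
    induction k with
    | zero =>
      intro x hx n _
      have : x = 0 := by simpa using hx
      simp [this]
    | succ k ih =>
      intro x hx n hn
      have h := hrec (n - 1) x
      rw [ih (N x) (by rwa [pow_succ] at hx) (n - 1) (by lia), if_neg (by lia), sub_zero,
        sub_add_cancel] at h
      exact h.symm
  have hNv : (N ^ k) (N v) = 0 := by
    rw [← mul_apply_eq_comp, ← pow_succ, pow_succ', mul_apply_eq_comp, hv,
      map_zero]
  have h := hrec (-1) v
  rw [key k (N v) hNv (-1) le_rfl, if_pos rfl] at h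
  rw [rieszProjection_eq_resolventMoment T μ ν r]
  exact (sub_eq_zero.mp h.symm)

theorem rieszProjection_apply_eigenvector_eq_zero {T : X →L[ℂ] X} {μ ν : ℂ} {r : ℝ} (hr : 0 < r)
    (hs : sphere μ r ⊆ resolventSet ℂ T) (hν : ν ∉ closedBall μ r) {v : X} (hv : T v = ν • v) :
    rieszProjection T μ r v = 0 := by
  have hν' : ν ∉ sphere μ r := fun h => hν (sphere_subset_closedBall h)
  have h := sub_mul_resolventMoment hr hs hν' (-1)
  have hc : Commute (T - algebraMap ℂ (X →L[ℂ] X) ν) (resolventMoment T μ r ν (-1)) :=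
    (commute_resolventMoment hr hs hν' (-1)).sub_left (Algebra.commutes ν _)
  rw [hc.eq, circleIntegral_sub_zpow_eq_zero hr.le hν, mul_zero, zero_smul, sub_zero] at h
  rw [rieszProjection_eq_resolventMoment T μ ν r]
  have h2 := congrArg (fun S : X →L[ℂ] X => S v) h
  simp only [mul_apply_eq_comp, sub_apply, hv] at h2
  rw [show (algebraMap ℂ (X →L[ℂ] X) ν) v = ν • v by simp [Algebra.algebraMap_eq_smul_one],
    sub_self, map_zero] at h2
  exact h2.symm

theorem rieszProjection_idem {T : X →L[ℂ] X} {μ : ℂ} {r : ℝ} (hr : 0 < r)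
    (h : closedBall μ r \ {μ} ⊆ resolventSet ℂ T) (v : X) :
    rieszProjection T μ r (rieszProjection T μ r v) = rieszProjection T μ r v := by
  rw [rieszProjection_eq_resolventMoment T μ μ r]
  exact congrArg (fun S : X →L[ℂ] X => S v) (isIdempotentElem_resolventMoment hr h)

theorem finiteDimensional_range_rieszProjection {T : X →L[ℂ] X} (hT : IsCompactOperator T)
    {μ : ℂ} {r : ℝ} (hr : 0 < r) (h : closedBall μ r \ {μ} ⊆ resolventSet ℂ T) (hμ : μ ≠ 0) :
    FiniteDimensional ℂ (LinearMap.range (rieszProjection T μ r : X →ₗ[ℂ] X)) := by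
  by_cases h0 : (0 : ℂ) ∈ closedBall μ r
  · have hu : IsUnit T := by
      have := h ⟨h0, Ne.symm hμ⟩
      rw [spectrum.mem_resolventSet_iff, map_zero, zero_sub] at this
      simpa using this
    obtain ⟨u, rfl⟩ := hu
    have hid : IsCompactOperator (id : X → X) := by
      have h1 := hT.clm_comp ((u⁻¹ : (X →L[ℂ] X)ˣ) : X →L[ℂ] X)
      have h2 : (((u⁻¹ : (X →L[ℂ] X)ˣ) : X →L[ℂ] X) ∘ (u : X →L[ℂ] X) : X → X) = id := by
        ext x
        exact congrArg (fun S : X →L[ℂ] X => S x) u.inv_mul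
      rwa [h2] at h1
    have := FiniteDimensional.of_isCompactOperator_id (𝕜 := ℂ) hid
    infer_instance
  · have hs := sphere_subset_of_punctured hr h
    have h0' : (0 : ℂ) ∉ sphere μ r := fun h => h0 (sphere_subset_closedBall h)
    have h1 := sub_mul_resolventMoment hr hs h0' (-1)
    rw [circleIntegral_sub_zpow_eq_zero hr.le h0, mul_zero, zero_smul, sub_zero, map_zero,
      sub_zero] at h1
    have hc : IsCompactOperator (rieszProjection T μ r) := by
      rw [rieszProjection_eq_resolventMoment T μ 0 r]
      have := hT.comp_clm (resolventMoment T μ r 0 (-1))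
      have h2 : (⇑T ∘ ⇑(resolventMoment T μ r 0 (-1))) = ⇑(resolventMoment T μ r 0 0) := by
        ext x
        exact congrArg (fun S : X →L[ℂ] X => S x) h1
      rwa [h2] at this
    set P := rieszProjection T μ r with hP
    have hidem : ∀ v, P (P v) = P v := rieszProjection_idem hr h
    have hclosed : IsClosed ((LinearMap.range (P : X →ₗ[ℂ] X) : Submodule ℂ X) : Set X) := by
      have : ((LinearMap.range (P : X →ₗ[ℂ] X) : Submodule ℂ X) : Set X) = {x | P x = x} := by
        ext x
        refine ⟨?_, fun hx => ⟨x, hx⟩⟩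
        rintro ⟨y, rfl⟩
        exact hidem y
      rw [this]
      exact isClosed_eq P.continuous continuous_id
    have hres := hc.restrict (f := (P : X →ₗ[ℂ] X))
      (fun x _ => LinearMap.mem_range_self (P : X →ₗ[ℂ] X) x) hclosed
    have hid : ⇑((P : X →ₗ[ℂ] X).restrict
        fun x _ => LinearMap.mem_range_self (P : X →ₗ[ℂ] X) x) =
        (id : LinearMap.range (P : X →ₗ[ℂ] X) → LinearMap.range (P : X →ₗ[ℂ] X)) := by
      ext ⟨x, y, rfl⟩
      exact hidem y
    rw [hid] at hres
    exact FiniteDimensional.of_isCompactOperator_id (𝕜 := ℂ) hres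

theorem mapsTo_range_rieszProjection {T : X →L[ℂ] X} {μ : ℂ} {r : ℝ} (hr : 0 < r)
    (hs : sphere μ r ⊆ resolventSet ℂ T) {v : X}
    (hv : v ∈ LinearMap.range (rieszProjection T μ r : X →ₗ[ℂ] X)) :
    T v ∈ LinearMap.range (rieszProjection T μ r : X →ₗ[ℂ] X) := by
  obtain ⟨y, rfl⟩ := hv
  have hc := commute_resolventMoment hr hs
    (notMem_sphere_of_mem_ball (mem_ball_self (x := μ) hr)) 0
  rw [← rieszProjection_eq_resolventMoment] at hc
  exact ⟨T y, (congrArg (fun S : X →L[ℂ] X => S y) hc.eq).symm⟩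

open Module.End in
theorem maxGenEigenspace_restrict_range_rieszProjection {T : X →L[ℂ] X} {μ : ℂ} {r : ℝ}
    (hr : 0 < r) (h : closedBall μ r \ {μ} ⊆ resolventSet ℂ T)
    [FiniteDimensional ℂ (LinearMap.range (rieszProjection T μ r : X →ₗ[ℂ] X))] :
    maxGenEigenspace ((T : X →ₗ[ℂ] X).restrict fun _ hv =>
      mapsTo_range_rieszProjection hr (sphere_subset_of_punctured hr h) hv) μ = ⊤ := by
  set f := (T : X →ₗ[ℂ] X).restrict fun _ hv =>
      mapsTo_range_rieszProjection hr (sphere_subset_of_punctured hr h) hv with hf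
  rw [← iSup_maxGenEigenspace_eq_top f]
  refine le_antisymm (le_iSup (maxGenEigenspace f) μ) (iSup_le fun ν => ?_)
  by_cases hνμ : ν = μ
  · rw [hνμ]
  suffices hno : ¬ HasEigenvalue f ν by
    have : maxGenEigenspace f ν = ⊥ := by
      by_contra hne
      apply hno
      rw [maxGenEigenspace_eq_genEigenspace_finrank] at hne
      exact HasUnifEigenvalue.lt zero_lt_one hne
    rw [this]
    exact bot_le
  intro hev
  obtain ⟨⟨v, hvV⟩, hv⟩ := hev.exists_hasEigenvector
  have hv0 : v ≠ 0 := fun h0 => hv.2 (by simp [h0])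
  have hTv : T v = ν • v := congrArg Subtype.val hv.apply_eq_smul
  by_cases hmem : ν ∈ closedBall μ r
  · have hu := h ⟨hmem, hνμ⟩
    have h1 := congrArg (fun S : X →L[ℂ] X => S v) (resolvent_mul_sub hu)
    simp only [mul_apply_eq_comp, sub_apply, hTv,
      Algebra.algebraMap_eq_smul_one, smul_apply,
      one_apply_eq_self, sub_self, map_zero] at h1
    exact hv0 h1.symm
  · obtain ⟨y, rfl⟩ := hvV
    apply hv0
    rw [← rieszProjection_apply_eigenvector_eq_zero hr (sphere_subset_of_punctured hr h) hmem hTv]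
    exact (rieszProjection_idem hr h y).symm

end RieszProjection

theorem Submodule.finrank_finsetSup_of_iSupIndep {K V ι : Type*} [Field K] [AddCommGroup V]
    [Module K V] [FiniteDimensional K V] {t : ι → Submodule K V} (h : iSupIndep t) (s : Finset ι) :
    Module.finrank K (s.sup t : Submodule K V) = ∑ i ∈ s, Module.finrank K (t i) := by
  classical
  induction s using Finset.induction_on with
  | empty => simp
  | insert a s ha ih =>
    have hd : Disjoint (t a) (s.sup t) := by
      rw [Finset.sup_eq_iSup]
      exact h.disjoint_biSup (y := (s : Set ι)) ha
    have := Submodule.finrank_sup_add_finrank_inf_eq (t a) (s.sup t)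
    rw [hd.eq_bot, finrank_bot, add_zero] at this
    rw [Finset.sup_insert, Finset.sum_insert ha, this, ih]

theorem Multiset.card_filter_eq_sum_count {α : Type*} [DecidableEq α] (s : Multiset α)
    (p : α → Prop) [DecidablePred p] :
    (s.filter p).card = ∑ a ∈ s.toFinset.filter p, s.count a := by
  rw [← Multiset.toFinset_sum_count_eq, Multiset.toFinset_filter]
  refine Finset.sum_congr rfl fun a ha => ?_
  rw [Multiset.count_filter_of_pos (Finset.mem_filter.mp ha).2]

theorem Multiset.sum_map_filter_le_sum {α ι : Type*} (s : Multiset α) (p : α → Prop)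
    [DecidablePred p] (Z : Finset ι) (q : ι → α → Prop) [∀ i, DecidablePred (q i)] {G : α → ℝ}
    (hG : ∀ x, 0 ≤ G x) (h : ∀ x ∈ s, p x → ∃ i ∈ Z, q i x) :
    ((s.filter p).map G).sum ≤ ∑ i ∈ Z, ((s.filter (q i)).map G).sum := by
  induction s using Multiset.induction_on with
  | empty => simp
  | cons a s ih =>
    have ih := ih fun x hx => h x (Multiset.mem_cons_of_mem hx)
    have hcons : ∀ (q : α → Prop) [DecidablePred q], (((a ::ₘ s).filter q).map G).sum =
        (if q a then G a else 0) + ((s.filter q).map G).sum := by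
      intro q _
      rw [Multiset.filter_cons]
      split_ifs <;> simp
    simp only [hcons, Finset.sum_add_distrib]
    refine add_le_add ?_ ih
    split_ifs with hpa
    · obtain ⟨i, hi, hq⟩ := h a (Multiset.mem_cons_self a s) hpa
      refine le_trans ?_ (Finset.single_le_sum (f := fun i => if q i a then G a else 0)
        (fun j _ => ?_) hi)
      · simp [hq]
      · split_ifs
        exacts [hG a, le_rfl]
    · refine Finset.sum_nonneg fun j _ => ?_
      split_ifs
      exacts [hG a, le_rfl]

section RootCount

open Metric

open scoped Classical in
/-- If the Riesz projections of `T` and `L` are close, then the number of eigenvalues inside the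
circle of the restriction of `T` to a finite-dimensional invariant subspace is at most the rank of
the Riesz projection of `L`. -/
theorem card_roots_charpoly_restrict_le {T L : X →L[ℂ] X} {μ : ℂ} {r : ℝ}
    (hs : sphere μ r ⊆ resolventSet ℂ T)
    (hP : ‖rieszProjection T μ r - rieszProjection L μ r‖ < 1)
    [FiniteDimensional ℂ (LinearMap.range (rieszProjection L μ r : X →ₗ[ℂ] X))]
    (W : Submodule ℂ X) [FiniteDimensional ℂ W] (hW : ∀ x ∈ W, (T : X →ₗ[ℂ] X) x ∈ W) :
    (((T : X →ₗ[ℂ] X).restrict hW).charpoly.roots.filter (· ∈ ball μ r)).card ≤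
      Module.finrank ℂ (LinearMap.range (rieszProjection L μ r : X →ₗ[ℂ] X)) := by
  set f : Module.End ℂ W := (T : X →ₗ[ℂ] X).restrict hW with hf
  set P := rieszProjection T μ r with hPT
  set Q := rieszProjection L μ r with hQ
  set s := f.charpoly.roots.toFinset.filter (· ∈ ball μ r) with hsdef
  have hcard : (f.charpoly.roots.filter (· ∈ ball μ r)).card =
      Module.finrank ℂ (s.sup f.maxGenEigenspace : Submodule ℂ W) := by
    rw [Submodule.finrank_finsetSup_of_iSupIndep f.independent_maxGenEigenspace,
      Multiset.card_filter_eq_sum_count]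
    refine Finset.sum_congr rfl fun ν _ => ?_
    rw [LinearMap.finrank_maxGenEigenspace_eq, Polynomial.count_roots]
  rw [hcard]
  set U := (s.sup f.maxGenEigenspace : Submodule ℂ W) with hU
  have hfix : ∀ v ∈ U, P (v : X) = v := by
    have hle : U ≤ LinearMap.ker (((P : X →ₗ[ℂ] X) - LinearMap.id) ∘ₗ W.subtype) := by
      refine Finset.sup_le fun ν hν => fun v hv => ?_
      obtain ⟨k, hk⟩ := (Module.End.mem_maxGenEigenspace _ _ _).mp hv
      have hpow : ∀ (k : ℕ) (v : W), (((f - ν • (1 : Module.End ℂ W)) ^ k) v : X) =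
          ((T - algebraMap ℂ (X →L[ℂ] X) ν) ^ k) (v : X) := by
        intro k
        induction k with
        | zero => simp
        | succ k ih =>
          intro v
          rw [pow_succ, pow_succ, Module.End.mul_apply, mul_apply_eq_comp, ih]
          simp [hf, Algebra.algebraMap_eq_smul_one]
      have h1 : P (v : X) = v := rieszProjection_apply_of_sub_pow_eq_zero hs (Finset.mem_filter.mp hν).2
        (v := (v : X)) (k := k) (by rw [← hpow, hk]; rfl)
      simp [h1]
    intro v hv
    have := hle hv
    simpa [sub_eq_zero] using this
  let g : U →ₗ[ℂ] LinearMap.range (Q : X →ₗ[ℂ] X) :=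
    (Q : X →ₗ[ℂ] X).rangeRestrict ∘ₗ W.subtype ∘ₗ U.subtype
  refine LinearMap.finrank_le_finrank_of_injective (f := g) ?_
  rw [← LinearMap.ker_eq_bot, LinearMap.ker_eq_bot']
  rintro ⟨v, hv⟩ hgv
  have hQv : Q (v : X) = 0 := congrArg Subtype.val hgv
  have h1 : ‖(v : X)‖ ≤ ‖P - Q‖ * ‖(v : X)‖ := by
    have := (P - Q).le_opNorm (v : X)
    rwa [sub_apply, hfix v hv, hQv, sub_zero] at this
  have h2 : (v : X) = 0 := by
    by_contra h0
    have := norm_pos_iff.mpr h0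
    nlinarith
  ext
  exact h2

end RootCount

section Compression

variable {W : Submodule ℂ X} [FiniteDimensional ℂ W]

/-- The matrix of the compression to `W` of `F ∘ G`, where `F` takes values in `W`. -/
noncomputable def compressionMatrix (F : X →L[ℂ] W) (G : X →L[ℂ] X) :
    Matrix (Fin (Module.finrank ℂ W)) (Fin (Module.finrank ℂ W)) ℂ :=
  LinearMap.toMatrix (Module.finBasis ℂ W) (Module.finBasis ℂ W)
    ((F : X →ₗ[ℂ] W) ∘ₗ (G : X →ₗ[ℂ] X) ∘ₗ W.subtype)

theorem differentiableAt_compressionMatrix (F : X →L[ℂ] W) {G : ℂ → X →L[ℂ] X} {w : ℂ}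
    (hG : DifferentiableAt ℂ G w) (i j : Fin (Module.finrank ℂ W)) :
    DifferentiableAt ℂ (fun w => compressionMatrix F (G w) i j) w := by
  have : (fun w => compressionMatrix F (G w) i j) = fun w =>
      LinearMap.toContinuousLinearMap ((Module.finBasis ℂ W).coord i)
        (F (G w (Module.finBasis ℂ W j : X))) := by
    ext w
    simp [compressionMatrix, LinearMap.toMatrix_apply]
  rw [this]
  fun_prop

theorem det_one_sub_compressionMatrix (F : X →L[ℂ] W) (G : X →L[ℂ] X) :
    (1 - compressionMatrix F G).det =
      LinearMap.det (LinearMap.id - (F : X →ₗ[ℂ] W) ∘ₗ (G : X →ₗ[ℂ] X) ∘ₗ W.subtype) := by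
  rw [← LinearMap.det_toMatrix (Module.finBasis ℂ W), map_sub, LinearMap.toMatrix_id]
  rfl

theorem isUnit_one_sub_of_det_ne_zero (F : X →L[ℂ] W) (G : X →L[ℂ] X)
    (h : (1 - compressionMatrix F G).det ≠ 0) :
    IsUnit (1 - (W.subtypeL ∘L F) * G) := by
  rw [det_one_sub_compressionMatrix] at h
  set D := LinearMap.id - (F : X →ₗ[ℂ] W) ∘ₗ (G : X →ₗ[ℂ] X) ∘ₗ W.subtype with hD
  have hu : IsUnit D := LinearMap.isUnit_iff_isUnit_det D |>.mpr h.isUnit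
  have hbij := (Module.End.isUnit_iff D).mp hu
  have hDv : ∀ v : W, D v = v - F (G v) := fun v => rfl
  have happ : ∀ x, (1 - (W.subtypeL ∘L F) * G) x = x - F (G x) := fun x => rfl
  rw [ContinuousLinearMap.isUnit_iff_bijective]
  constructor
  · rw [injective_iff_map_eq_zero]
    intro x hx
    rw [happ, sub_eq_zero] at hx
    have h1 : D (F (G x)) = D 0 := by
      rw [hDv, map_zero, ← hx, sub_self]
    rw [hx, hbij.1 h1]
    rfl
  · intro y
    obtain ⟨u, hu⟩ := hbij.2 (F (G y))
    rw [hDv] at hu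
    refine ⟨y + u, ?_⟩
    rw [happ, map_add, map_add, ← hu]
    simp

end Compression

theorem DifferentiableAt.matrix_mul {n : ℕ} {M N : ℂ → Matrix (Fin n) (Fin n) ℂ} {w : ℂ}
    (hM : ∀ i j, DifferentiableAt ℂ (fun w => M w i j) w)
    (hN : ∀ i j, DifferentiableAt ℂ (fun w => N w i j) w) (i j : Fin n) :
    DifferentiableAt ℂ (fun w => (M w * N w) i j) w := by
  simp only [Matrix.mul_apply]
  exact DifferentiableAt.fun_sum fun k _ => (hM i k).mul (hN k j)

theorem DifferentiableAt.matrix_pow {n : ℕ} {M : ℂ → Matrix (Fin n) (Fin n) ℂ} {w : ℂ}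
    (hM : ∀ i j, DifferentiableAt ℂ (fun w => M w i j) w) (k : ℕ) (i j : Fin n) :
    DifferentiableAt ℂ (fun w => (M w ^ k) i j) w := by
  induction k generalizing i j with
  | zero => simp
  | succ k ih =>
    simp only [pow_succ]
    exact DifferentiableAt.matrix_mul ih hM i j

theorem DifferentiableAt.matrix_det {n : ℕ} {M : ℂ → Matrix (Fin n) (Fin n) ℂ} {w : ℂ}
    (hM : ∀ i j, DifferentiableAt ℂ (fun w => M w i j) w) :
    DifferentiableAt ℂ (fun w => (M w).det) w := by
  simp only [Matrix.det_apply']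
  exact DifferentiableAt.fun_sum fun σ _ =>
    (DifferentiableAt.fun_finsetProd fun i _ => hM (σ i) i).const_mul _

theorem DifferentiableAt.matrix_trace {n : ℕ} {M : ℂ → Matrix (Fin n) (Fin n) ℂ} {w : ℂ}
    (hM : ∀ i j, DifferentiableAt ℂ (fun w => M w i j) w) :
    DifferentiableAt ℂ (fun w => (M w).trace) w := by
  simp only [Matrix.trace, Matrix.diag_apply]
  exact DifferentiableAt.fun_sum fun i _ => hM i i

section Isolation

open Metric

theorem finite_spectrum_norm_ge {L : X →L[ℂ] X} (hL : ∀ ε > 0, ∃ F, IsFiniteRank F ∧ ‖L - F‖ < ε)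
    {ε : ℝ} (hε : 0 < ε) : {μ ∈ spectrum ℂ L | ε ≤ ‖μ‖}.Finite := by
  obtain ⟨F, hF, hFL⟩ := hL (ε / 2) (by positivity)
  set N := L - F with hN
  set W := LinearMap.range (F : X →ₗ[ℂ] X) with hW
  have : FiniteDimensional ℂ W := hF
  let F₀ : X →L[ℂ] W := F.codRestrict W fun x => LinearMap.mem_range_self (F : X →ₗ[ℂ] X) x
  have hF₀ : W.subtypeL ∘L F₀ = F := rfl
  have hunit : ∀ w ∈ ball (0 : ℂ) (2 / ε), IsUnit (1 - w • N) := by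
    intro w hw
    apply isUnit_one_sub_of_norm_lt_one
    rw [norm_smul]
    rw [mem_ball_zero_iff] at hw
    calc ‖w‖ * ‖N‖ ≤ ‖w‖ * (ε / 2) := by gcongr
      _ < 2 / ε * (ε / 2) := by gcongr
      _ = 1 := by field_simp
  let G : ℂ → X →L[ℂ] X := fun w => w • Ring.inverse (1 - w • N)
  have hG : ∀ w ∈ ball (0 : ℂ) (2 / ε), DifferentiableAt ℂ G w := by
    intro w hw
    obtain ⟨u, hu⟩ := hunit w hw
    have h1 : DifferentiableAt ℂ (Ring.inverse : (X →L[ℂ] X) → _) (1 - w • N) := by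
      rw [← hu]
      exact (differentiableAt_inverse (𝕜 := ℂ) u.isUnit)
    have h3 : DifferentiableAt ℂ (fun w : ℂ => 1 - w • N) w := by fun_prop
    have h2 : DifferentiableAt ℂ (fun w : ℂ => Ring.inverse (1 - w • N)) w :=
      DifferentiableAt.comp (g := Ring.inverse) (f := fun w : ℂ => 1 - w • N) w h1 h3
    exact differentiableAt_fun_id.fun_smul h2
  let f : ℂ → ℂ := fun w => (1 - compressionMatrix F₀ (G w)).det
  have hf : AnalyticOnNhd ℂ f (ball 0 (2 / ε)) := by
    refine DifferentiableOn.analyticOnNhd (fun w hw => ?_) isOpen_ball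
    refine (DifferentiableAt.matrix_det fun i j => ?_).differentiableWithinAt
    simp only [Matrix.sub_apply]
    exact (differentiableAt_const _).sub (differentiableAt_compressionMatrix F₀ (hG w hw) i j)
  have hf0 : f 0 = 1 := by
    have : compressionMatrix F₀ (G 0) = 0 := by
      simp [compressionMatrix, G]
    simp [f, this]
  have hsub : closedBall (0 : ℂ) (1 / ε) ⊆ ball 0 (2 / ε) := closedBall_subset_ball (by gcongr; norm_num)
  have hzeros : {w ∈ closedBall (0 : ℂ) (1 / ε) | f w = 0}.Finite := by
    by_contra hinf
    obtain ⟨x, hx, hacc⟩ := Set.Infinite.exists_accPt_of_subset_isCompact hinf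
      (isCompact_closedBall (0 : ℂ) (1 / ε)) fun w hw => hw.1
    have hfreq : ∃ᶠ z in nhdsWithin x {x}ᶜ, f z = 0 := by
      rw [accPt_iff_frequently_nhdsNE] at hacc
      exact hacc.mono fun z hz => hz.2
    have := hf.eqOn_zero_of_preconnected_of_frequently_eq_zero
      (convex_ball (0 : ℂ) (2 / ε)).isPreconnected (hsub hx) hfreq
      (mem_ball_self (by positivity))
    simp [hf0] at this
  refine (hzeros.image fun w => w⁻¹).subset ?_
  rintro μ ⟨hμ, hμε⟩
  have hμ0 : μ ≠ 0 := by
    rintro rfl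
    simp at hμε
    linarith
  refine ⟨μ⁻¹, ⟨?_, ?_⟩, inv_inv μ⟩
  · rw [mem_closedBall_zero_iff, norm_inv, ← one_div]
    gcongr
  by_contra hne
  have hw : μ⁻¹ ∈ ball (0 : ℂ) (2 / ε) := by
    apply hsub
    rw [mem_closedBall_zero_iff, norm_inv, ← one_div]
    gcongr
  have h1 := isUnit_one_sub_of_det_ne_zero F₀ (G μ⁻¹) hne
  have h2 := h1.mul (hunit _ hw)
  have h3 : (1 - (W.subtypeL ∘L F₀) * G μ⁻¹) * (1 - μ⁻¹ • N) = 1 - μ⁻¹ • L := by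
    rw [hF₀, sub_mul, mul_assoc]
    simp only [G, smul_mul_assoc, Ring.inverse_mul_cancel _ (hunit _ hw)]
    rw [hN, smul_sub, one_mul, mul_smul_comm, mul_one]
    abel
  rw [h3] at h2
  apply hμ
  have h4 : algebraMap ℂ (X →L[ℂ] X) μ - L = algebraMap ℂ (X →L[ℂ] X) μ * (1 - μ⁻¹ • L) := by
    rw [mul_sub, mul_one, mul_smul_comm, ← smul_mul_assoc, Algebra.algebraMap_eq_smul_one,
      smul_smul, inv_mul_cancel₀ hμ0, one_smul, one_mul]
  rw [spectrum.mem_resolventSet_iff, h4]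
  exact ((IsUnit.mk0 μ hμ0).map (algebraMap ℂ (X →L[ℂ] X))).mul h2

end Isolation

section Semicontinuity

open Metric Filter Topology

theorem IsFiniteRank.isCompactOperator {F : X →L[ℂ] X} (hF : IsFiniteRank F) :
    IsCompactOperator F := by
  set W := LinearMap.range (F : X →ₗ[ℂ] X) with hW
  have : FiniteDimensional ℂ W := hF
  have : LocallyCompactSpace W := have := FiniteDimensional.proper ℂ W; locallyCompact_of_proper
  let F₀ : X →L[ℂ] W := F.codRestrict W fun x => LinearMap.mem_range_self (F : X →ₗ[ℂ] X) x
  have h : IsCompactOperator F₀ := isCompactOperator_of_locallyCompactSpace_dom (F₀ : X →L[ℂ] W)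
  exact h.clm_comp W.subtypeL

theorem isCompactOperator_of_approx {L : X →L[ℂ] X}
    (hL : ∀ ε > 0, ∃ F, IsFiniteRank F ∧ ‖L - F‖ < ε) : IsCompactOperator L := by
  have h : L ∈ closure {f : X →L[ℂ] X | IsCompactOperator f} := by
    rw [Metric.mem_closure_iff]
    intro ε hε
    obtain ⟨F, hF, h⟩ := hL ε hε
    exact ⟨F, hF.isCompactOperator, by rwa [dist_eq_norm]⟩
  rwa [isClosed_setOfPred_isCompactOperator.closure_eq] at h

theorem closedBall_diff_subset_resolventSet {T : X →L[ℂ] X} {μ : ℂ} {r : ℝ}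
    (h : ∀ z ∈ closedBall μ r, z ≠ μ → z ∉ spectrum ℂ T) :
    closedBall μ r \ {μ} ⊆ resolventSet ℂ T := fun z hz =>
  not_not.mp (h z hz.1 hz.2)

/-- A radius isolating `μ` from the rest of the spectrum, at which the algebraic multiplicity is
computed. -/
theorem exists_radius_of_isolated {T : X →L[ℂ] X} {μ : ℂ}
    (h : ∃ r, 0 < r ∧ ∀ z ∈ closedBall μ r, z ≠ μ → z ∉ spectrum ℂ T) :
    ∃ r, 0 < r ∧ closedBall μ r \ {μ} ⊆ resolventSet ℂ T ∧ algebraicMultiplicity T μ =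
      Module.finrank ℂ (LinearMap.range (rieszProjection T μ r : X →ₗ[ℂ] X)) :=
  ⟨h.choose, h.choose_spec.1, closedBall_diff_subset_resolventSet h.choose_spec.2, by
    rw [algebraicMultiplicity, dif_pos h]⟩

theorem exists_isolated_of_approx {L : X →L[ℂ] X}
    (hL : ∀ ε > 0, ∃ F, IsFiniteRank F ∧ ‖L - F‖ < ε) {μ : ℂ} (hμ : μ ≠ 0) :
    ∃ r, 0 < r ∧ ∀ z ∈ closedBall μ r, z ≠ μ → z ∉ spectrum ℂ L := by
  have hfin := finite_spectrum_norm_ge hL (ε := ‖μ‖ / 2) (by positivity)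
  have hopen : IsOpen ({z ∈ spectrum ℂ L | ‖μ‖ / 2 ≤ ‖z‖} \ {μ})ᶜ :=
    (hfin.subset Set.sdiff_subset).isClosed.isOpen_compl
  obtain ⟨r, hr, hsub⟩ := Metric.isOpen_iff.mp hopen μ (by simp)
  have hμ' : 0 < ‖μ‖ := norm_pos_iff.mpr hμ
  refine ⟨min (r / 2) (‖μ‖ / 2), by positivity, fun z hz hzμ hzs => ?_⟩
  rw [mem_closedBall] at hz
  have h1 : z ∈ ball μ r := by
    rw [mem_ball]; linarith [min_le_left (r / 2) (‖μ‖ / 2)]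
  refine hsub h1 ⟨⟨hzs, ?_⟩, hzμ⟩
  have h2 : ‖μ‖ - ‖z‖ ≤ dist z μ := by
    rw [dist_comm, dist_eq_norm]; exact norm_sub_norm_le μ z
  linarith [min_le_right (r / 2) (‖μ‖ / 2)]

theorem isDiscreteEigenvalue_of_approx {L : X →L[ℂ] X}
    (hL : ∀ ε > 0, ∃ F, IsFiniteRank F ∧ ‖L - F‖ < ε) {μ : ℂ} (hμ : μ ≠ 0)
    (hs : μ ∈ spectrum ℂ L) : IsDiscreteEigenvalue L μ := by
  obtain ⟨r, hr, h⟩ := exists_isolated_of_approx hL hμ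
  exact ⟨hs, r, hr, h, finiteDimensional_range_rieszProjection (isCompactOperator_of_approx hL) hr
    (closedBall_diff_subset_resolventSet h) hμ⟩

theorem mem_spectrum_of_mem_roots {T : X →L[ℂ] X} {W : Submodule ℂ X} [FiniteDimensional ℂ W]
    {hW : ∀ x ∈ W, (T : X →ₗ[ℂ] X) x ∈ W} {ν : ℂ}
    (hν : ν ∈ ((T : X →ₗ[ℂ] X).restrict hW).charpoly.roots) : ν ∈ spectrum ℂ T := by
  set f : Module.End ℂ W := (T : X →ₗ[ℂ] X).restrict hW with hf
  have h1 : Module.End.HasEigenvalue f ν := by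
    rw [Module.End.hasEigenvalue_iff_isRoot_charpoly]
    exact Polynomial.isRoot_of_mem_roots hν
  obtain ⟨v, hv⟩ := h1.exists_hasEigenvector
  have hTv : T (v : X) = ν • (v : X) := congrArg Subtype.val hv.apply_eq_smul
  intro hu
  obtain ⟨u, hu⟩ := spectrum.mem_resolventSet_iff.mp hu
  have h0 : (u : X →L[ℂ] X) (v : X) = 0 := by
    rw [hu, Algebra.algebraMap_eq_smul_one]
    simp [hTv]
  have : (v : X) = 0 := by
    have h2 : ((↑u⁻¹ * ↑u : X →L[ℂ] X)) (v : X) = v := by rw [Units.inv_mul]; rfl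
    rw [← h2]
    show (↑u⁻¹ : X →L[ℂ] X) ((u : X →L[ℂ] X) (v : X)) = 0
    rw [h0, map_zero]
  exact hv.2 (Subtype.ext this)

open scoped Classical in
theorem exists_eventually_sum_roots_le {L : X →L[ℂ] X}
    (hL : ∀ ε > 0, ∃ F, IsFiniteRank F ∧ ‖L - F‖ < ε) {ε : ℝ} (hε : 0 < ε) :
    ∃ Z : Finset ℂ, (∀ μ ∈ Z, IsDiscreteEigenvalue L μ) ∧ ∀ G : ℂ → ℝ, Continuous G →
      (∀ z, 0 ≤ G z) → ∀ δ > 0, ∀ᶠ T : X →L[ℂ] X in 𝓝 L, ∀ (W : Submodule ℂ X) [FiniteDimensional ℂ W]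
        (hW : ∀ x ∈ W, (T : X →ₗ[ℂ] X) x ∈ W),
        ((((T : X →ₗ[ℂ] X).restrict hW).charpoly.roots.filter (ε ≤ ‖·‖)).map G).sum ≤
          ∑ μ ∈ Z, algebraicMultiplicity L μ * G μ + δ := by
  have hfin := finite_spectrum_norm_ge hL hε
  have hne : ∀ μ ∈ hfin.toFinset, μ ≠ 0 := by
    intro μ hμ h0
    have := (hfin.mem_toFinset.mp hμ).2
    rw [h0, norm_zero] at this
    linarith
  refine ⟨hfin.toFinset, fun μ hμ => isDiscreteEigenvalue_of_approx hL (hne μ hμ)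
    (hfin.mem_toFinset.mp hμ).1, fun G hG hG0 δ hδ => ?_⟩
  set Z := hfin.toFinset with hZ
  set D : ℝ := ∑ μ ∈ Z, (algebraicMultiplicity L μ : ℝ) with hD
  have hD0 : 0 ≤ D := Finset.sum_nonneg fun _ _ => Nat.cast_nonneg _
  have key : ∀ μ ∈ Z, ∃ η > 0, closedBall μ η \ {μ} ⊆ resolventSet ℂ L ∧
      (∀ z ∈ ball μ η, G z ≤ G μ + δ / (D + 1)) ∧
      FiniteDimensional ℂ (LinearMap.range (rieszProjection L μ η : X →ₗ[ℂ] X)) ∧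
      algebraicMultiplicity L μ =
        Module.finrank ℂ (LinearMap.range (rieszProjection L μ η : X →ₗ[ℂ] X)) := by
    intro μ hμ
    obtain ⟨r, hr, hsub, hmult⟩ := exists_radius_of_isolated
      (exists_isolated_of_approx hL (hne μ hμ))
    have hcont := (hG.continuousAt (x := μ)).eventually (Metric.ball_mem_nhds (G μ)
      (show 0 < δ / (D + 1) by positivity))
    obtain ⟨η, hη, hηG⟩ := Metric.eventually_nhds_iff_ball.mp hcont
    have hsub' : closedBall μ (min r η) \ {μ} ⊆ resolventSet ℂ L := fun z hz =>
      hsub ⟨closedBall_subset_closedBall (min_le_left _ _) hz.1, hz.2⟩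
    refine ⟨min r η, by positivity, hsub', fun z hz => ?_,
      finiteDimensional_range_rieszProjection (isCompactOperator_of_approx hL) (by positivity)
        hsub' (hne μ hμ), ?_⟩
    · have := hηG z (ball_subset_ball (min_le_right _ _) hz)
      rw [Real.dist_eq] at this
      linarith [le_abs_self (G z - G μ)]
    · rw [hmult, rieszProjection_eq_resolventMoment L μ μ r,
        rieszProjection_eq_resolventMoment L μ μ (min r η),
        resolventMoment_eq_of_le (by positivity) (min_le_left r η) hsub]
  choose! η hη hsub hGη hfd hmult using key
  set E : Set ℂ := (closedBall (0 : ℂ) ((‖L‖ + 1) * ‖(1 : X →L[ℂ] X)‖) ∩ {z | ε ≤ ‖z‖}) \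
    ⋃ μ ∈ Z, ball μ (η μ) with hE
  have hEc : IsCompact E := by
    refine ((isCompact_closedBall _ _).inter_right (isClosed_le continuous_const
      continuous_norm)).diff ?_
    exact isOpen_biUnion fun _ _ => isOpen_ball
  have hEr : E ⊆ resolventSet ℂ L := by
    rintro z ⟨⟨-, hz⟩, hz'⟩
    by_contra hzs
    exact hz' (Set.mem_biUnion (hfin.mem_toFinset.mpr ⟨hzs, hz⟩) (mem_ball_self (hη z
      (hfin.mem_toFinset.mpr ⟨hzs, hz⟩))))
  have hsph : ∀ μ ∈ Z, sphere μ (η μ) ⊆ resolventSet ℂ L := fun μ hμ =>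
    sphere_subset_of_punctured (hη μ hμ) (hsub μ hμ)
  have ev1 := eventually_norm_resolvent_sub_le L hEc hEr one_pos
  have ev2 : ∀ᶠ T in 𝓝 L, ∀ μ ∈ Z, sphere μ (η μ) ⊆ resolventSet ℂ T :=
    (Filter.eventually_all_finset Z).mpr fun μ hμ =>
      (eventually_norm_resolvent_sub_le L (isCompact_sphere _ _) (hsph μ hμ) one_pos).mono
        fun T hT => hT.1
  have ev3 : ∀ᶠ T in 𝓝 L, ∀ μ ∈ Z,
      ‖rieszProjection T μ (η μ) - rieszProjection L μ (η μ)‖ < 1 := by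
    refine (Filter.eventually_all_finset Z).mpr fun μ hμ => ?_
    have := tendsto_resolventMoment_zero L (hη μ hμ) (hsph μ hμ)
    filter_upwards [this (ball_mem_nhds _ one_pos)] with T hT
    rw [rieszProjection_eq_resolventMoment T μ μ, rieszProjection_eq_resolventMoment L μ μ]
    rw [← dist_eq_norm]
    exact hT
  filter_upwards [ev1, ev2, ev3, ball_mem_nhds L one_pos] with T h1 h2 h3 h4 W _ hW
  set s := ((T : X →ₗ[ℂ] X).restrict hW).charpoly.roots with hs
  have hTn : ‖T‖ ≤ ‖L‖ + 1 := by
    have : ‖T‖ ≤ ‖L‖ + ‖T - L‖ := by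
      calc ‖T‖ = ‖L + (T - L)‖ := by abel_nf
        _ ≤ _ := norm_add_le _ _
    rw [mem_ball, dist_eq_norm] at h4
    linarith
  have hcover : ∀ x ∈ s, ε ≤ ‖x‖ → ∃ μ ∈ Z, x ∈ ball μ (η μ) := by
    intro x hx hxε
    have hxs := mem_spectrum_of_mem_roots hx
    by_contra! hcon
    refine hxs (h1.1 ⟨⟨?_, hxε⟩, ?_⟩)
    · rw [mem_closedBall_zero_iff]
      exact (spectrum.norm_le_norm_mul_of_mem hxs).trans (by gcongr)
    · simpa using hcon
  refine (Multiset.sum_map_filter_le_sum s (ε ≤ ‖·‖) Z (fun μ x => x ∈ ball μ (η μ)) hG0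
    hcover).trans ?_
  have hterm : ∀ μ ∈ Z, ((s.filter (· ∈ ball μ (η μ))).map G).sum ≤
      algebraicMultiplicity L μ * (G μ + δ / (D + 1)) := by
    intro μ hμ
    have := hfd μ hμ
    have hc := card_roots_charpoly_restrict_le (h2 μ hμ) (h3 μ hμ) W hW
    rw [← hmult μ hμ] at hc
    have hGm : 0 ≤ G μ + δ / (D + 1) := add_nonneg (hG0 μ) (by positivity)
    calc ((s.filter (· ∈ ball μ (η μ))).map G).sum
        ≤ ((s.filter (· ∈ ball μ (η μ))).map G).card • (G μ + δ / (D + 1)) := by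
          refine Multiset.sum_le_card_nsmul _ _ fun y hy => ?_
          obtain ⟨z, hz, rfl⟩ := Multiset.mem_map.mp hy
          exact hGη μ hμ z (Multiset.mem_filter.mp hz).2
      _ ≤ algebraicMultiplicity L μ * (G μ + δ / (D + 1)) := by
          rw [Multiset.card_map, nsmul_eq_mul]
          gcongr
  refine (Finset.sum_le_sum hterm).trans ?_
  simp only [mul_add, Finset.sum_add_distrib, ← Finset.sum_mul]
  rw [← hD]
  gcongr
  rw [mul_div_assoc', div_le_iff₀ (by positivity)]
  nlinarith

end Semicontinuity

section RootSums

open Filter Topology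

theorem sum_algebraicMultiplicity_le_of_eigSum_le {p b : ℝ} (hb : 0 ≤ b) {L : X →L[ℂ] X}
    (h : eigSum p L ≤ ENNReal.ofReal b) {Z : Finset ℂ}
    (hZ : ∀ μ ∈ Z, IsDiscreteEigenvalue L μ) :
    ∑ μ ∈ Z, algebraicMultiplicity L μ * ‖μ‖ ^ p ≤ b := by
  have h1 : ∑ μ ∈ Z.attach, ENNReal.ofReal (algebraicMultiplicity L μ * ‖(μ : ℂ)‖ ^ p) ≤
      eigSum p L := by
    let e : Z ↪ {μ : ℂ // IsDiscreteEigenvalue L μ} :=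
      ⟨fun μ => ⟨μ, hZ μ μ.2⟩, fun a b hab => Subtype.ext (Subtype.mk.inj hab)⟩
    have := ENNReal.sum_le_tsum (f := fun μ : {μ : ℂ // IsDiscreteEigenvalue L μ} =>
      (algebraicMultiplicity L (μ : ℂ) : ENNReal) * ENNReal.ofReal (‖(μ : ℂ)‖ ^ p))
      (Z.attach.map e)
    rw [Finset.sum_map] at this
    refine le_trans (le_of_eq (Finset.sum_congr rfl fun μ _ => ?_)) this
    rw [ENNReal.ofReal_mul (Nat.cast_nonneg _), ENNReal.ofReal_natCast]
    rfl
  rw [← ENNReal.ofReal_sum_of_nonneg fun _ _ => by positivity] at h1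
  rw [← Finset.sum_attach]
  exact (ENNReal.ofReal_le_ofReal_iff hb).mp (h1.trans h)

theorem sum_roots_rpow_le {p b : ℝ} (hp : 0 < p) (hb : 0 ≤ b) {L : X →L[ℂ] X}
    (hL : ∀ ε > 0, ∃ F, IsFiniteRank F ∧ ‖L - F‖ < ε) (h : eigSum p L ≤ ENNReal.ofReal b)
    (W : Submodule ℂ X) [FiniteDimensional ℂ W] (hW : ∀ x ∈ W, (L : X →ₗ[ℂ] X) x ∈ W) :
    (((L : X →ₗ[ℂ] X).restrict hW).charpoly.roots.map fun ν => ‖ν‖ ^ p).sum ≤ b := by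
  classical
  set s := ((L : X →ₗ[ℂ] X).restrict hW).charpoly.roots with hs
  obtain ⟨ε, hε, hsε⟩ : ∃ ε > 0, ∀ ν ∈ s, ν ≠ 0 → ε ≤ ‖ν‖ := by
    rcases (s.toFinset.filter (· ≠ 0)).eq_empty_or_nonempty with he | hne
    · refine ⟨1, one_pos, fun ν hν h0 => ?_⟩
      have : ν ∈ s.toFinset.filter (· ≠ 0) := by simp [hν, h0]
      simp [he] at this
    · obtain ⟨x, hx, hmin⟩ := (s.toFinset.filter (· ≠ 0)).exists_min_image (‖·‖) hne
      refine ⟨‖x‖, norm_pos_iff.mpr (Finset.mem_filter.mp hx).2, fun ν hν h0 => hmin ν ?_⟩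
      simp [hν, h0]
  obtain ⟨Z, hZ, hG⟩ := exists_eventually_sum_roots_le hL hε
  refine le_of_forall_pos_le_add fun δ hδ => ?_
  have h1 := (hG (fun z => ‖z‖ ^ p) (continuous_norm.rpow_const fun _ => Or.inr hp.le)
    (fun _ => by positivity) δ hδ).self_of_nhds W hW
  have h2 : ((s.filter fun x => ¬ ε ≤ ‖x‖).map fun ν => ‖ν‖ ^ p).sum = 0 := by
    refine Multiset.sum_eq_zero fun y hy => ?_
    obtain ⟨z, hz, rfl⟩ := Multiset.mem_map.mp hy
    obtain ⟨hzs, hzε⟩ := Multiset.mem_filter.mp hz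
    have : z = 0 := by
      by_contra h0
      exact hzε (hsε z hzs h0)
    rw [this, norm_zero, Real.zero_rpow hp.ne']
  have h3 := sum_algebraicMultiplicity_le_of_eigSum_le hb h hZ
  rw [← Multiset.filter_add_not (fun x : ℂ => ε ≤ ‖x‖) s, Multiset.map_add, Multiset.sum_add, h2]
  linarith

theorem norm_prod_map_le_exp {s : Multiset ℂ} {f : ℂ → ℂ} {g : ℂ → ℝ}
    (h : ∀ z ∈ s, ‖f z‖ ≤ Real.exp (g z)) : ‖(s.map f).prod‖ ≤ Real.exp (s.map g).sum := by
  induction s using Multiset.induction_on with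
  | empty => simp
  | cons a s ih =>
    simp only [Multiset.map_cons, Multiset.prod_cons, Multiset.sum_cons, Real.exp_add, norm_mul]
    exact mul_le_mul (h a (Multiset.mem_cons_self a s))
      (ih fun z hz => h z (Multiset.mem_cons_of_mem hz)) (norm_nonneg _) (Real.exp_pos _).le

theorem Real.log_le_of_le_exp {x b : ℝ} (hb : 0 ≤ b) (hx0 : 0 ≤ x) (hx : x ≤ Real.exp b) :
    Real.log x ≤ b := by
  rcases hx0.eq_or_lt with h | h
  · rw [← h, Real.log_zero]; exact hb
  · exact (Real.log_le_iff_le_exp h).mpr hx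

theorem Multiset.sum_map_norm_rpow_nonneg (s : Multiset ℂ) (p : ℝ) :
    0 ≤ (s.map fun ν => ‖ν‖ ^ p).sum :=
  Multiset.sum_nonneg fun y hy => by
    obtain ⟨z, -, rfl⟩ := Multiset.mem_map.mp hy
    positivity

variable {m : ℕ} {p Γ : ℝ}

theorem log_norm_prod_modFactor_le {N : ℕ} (hN : 1 ≤ N) (hm : 1 ≤ m) (hp : 0 < p) (hpm : p ≤ m)
    (hΓ : 0 ≤ Γ)
    (hE : ∀ z : ℂ, ‖(1 - z) * Complex.exp (∑ j ∈ Finset.Icc 1 (m - 1), z ^ j / (j : ℂ))‖ ≤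
      Real.exp (Γ * ‖z‖ ^ p)) {s : Multiset ℂ} {b : ℝ}
    (hb : (s.map fun ν => ‖ν‖ ^ p).sum ≤ b) :
    Real.log ‖(s.map (modFactor m N)).prod‖ ≤ N * ((Γ + m / p) * b) := by
  have hb0 := (s.sum_map_norm_rpow_nonneg p).trans hb
  refine Real.log_le_of_le_exp (by positivity) (norm_nonneg _)
    ((norm_prod_map_le_exp (g := fun z => N * (Γ + m / p) * ‖z‖ ^ p) fun z _ =>
      (norm_modFactor_le hN hE z).trans (Real.exp_le_exp.mpr ?_)).trans
      (Real.exp_le_exp.mpr ?_))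
  · rw [mul_assoc, add_mul]
    gcongr
    exact corrTerm_le hm hp hpm (norm_nonneg z)
  · rw [Multiset.sum_map_mul_left, mul_assoc]
    gcongr

theorem exists_sum_corrTerm_le (hm : 1 ≤ m) (hp : 0 < p) (hpm : p ≤ m) {L : X →L[ℂ] X}
    (h : eigSum p L ≠ ⊤) {δ : ℝ} (hδ : 0 < δ) :
    ∃ N₀ : ℕ, ∀ N ≥ N₀, ∀ Z : Finset ℂ, (∀ μ ∈ Z, IsDiscreteEigenvalue L μ) →
      ∑ μ ∈ Z, algebraicMultiplicity L μ * corrTerm m N ‖μ‖ ≤ δ := by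
  have hsum : Summable fun μ : {μ : ℂ // IsDiscreteEigenvalue L μ} =>
      (algebraicMultiplicity L (μ : ℂ) : ℝ) * ‖(μ : ℂ)‖ ^ p := by
    refine (ENNReal.summable_toReal h).congr fun μ => ?_
    rw [ENNReal.toReal_mul, ENNReal.toReal_ofReal (by positivity), ENNReal.toReal_natCast]
  have hbound : ∀ N (μ : {μ : ℂ // IsDiscreteEigenvalue L μ}),
      ‖(algebraicMultiplicity L (μ : ℂ) : ℝ) * corrTerm m N ‖(μ : ℂ)‖‖ ≤
        m / p * ((algebraicMultiplicity L (μ : ℂ) : ℝ) * ‖(μ : ℂ)‖ ^ p) := by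
    intro N μ
    have h0 := corrTerm_nonneg m N (norm_nonneg (μ : ℂ))
    rw [Real.norm_of_nonneg (by positivity), mul_left_comm]
    gcongr
    exact corrTerm_le hm hp hpm (norm_nonneg _)
  have ht := tendsto_tsum_of_dominated_convergence (𝓕 := atTop) (g := fun _ => (0 : ℝ))
    (hsum.mul_left (m / p : ℝ))
    (fun μ => by
      simpa using (tendsto_corrTerm m (norm_nonneg (μ : ℂ))).const_mul
        (algebraicMultiplicity L (μ : ℂ) : ℝ))
    (Eventually.of_forall fun N μ => hbound N μ)
  rw [tsum_zero] at ht
  obtain ⟨N₀, hN₀⟩ := eventually_atTop.mp (ht.eventually (gt_mem_nhds hδ))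
  refine ⟨N₀, fun N hN Z hZ => le_trans ?_ (hN₀ N hN).le⟩
  let e : Z ↪ {μ : ℂ // IsDiscreteEigenvalue L μ} :=
    ⟨fun μ => ⟨μ, hZ μ μ.2⟩, fun a b hab => Subtype.ext (Subtype.mk.inj hab)⟩
  have hs : Summable fun μ : {μ : ℂ // IsDiscreteEigenvalue L μ} =>
      (algebraicMultiplicity L (μ : ℂ) : ℝ) * corrTerm m N ‖(μ : ℂ)‖ :=
    Summable.of_norm_bounded (hsum.mul_left (m / p : ℝ)) (hbound N)
  have := hs.sum_le_tsum (Z.attach.map e) fun μ _ =>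
    mul_nonneg (Nat.cast_nonneg _) (corrTerm_nonneg m N (norm_nonneg (μ : ℂ)))
  rw [Finset.sum_map] at this
  rwa [← Finset.sum_attach]

theorem eventually_log_norm_prod_modFactor_le (hm : 1 ≤ m) (hp : 0 < p) (hpm : p ≤ m)
    (hΓ : 0 ≤ Γ)
    (hE : ∀ z : ℂ, ‖(1 - z) * Complex.exp (∑ j ∈ Finset.Icc 1 (m - 1), z ^ j / (j : ℂ))‖ ≤
      Real.exp (Γ * ‖z‖ ^ p)) {L : X →L[ℂ] X}
    (hL : ∀ ε > 0, ∃ F, IsFiniteRank F ∧ ‖L - F‖ < ε) {b : ℝ} (hb : 0 ≤ b)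
    (h : eigSum p L ≤ ENNReal.ofReal b) {δ : ℝ} (hδ : 0 < δ) (c : ℝ) :
    ∃ N₀ : ℕ, ∀ N ≥ N₀, 1 ≤ N → ∀ᶠ T : X →L[ℂ] X in 𝓝 L,
      ∀ (W : Submodule ℂ X) [FiniteDimensional ℂ W] (hW : ∀ x ∈ W, (T : X →ₗ[ℂ] X) x ∈ W),
        (((T : X →ₗ[ℂ] X).restrict hW).charpoly.roots.map fun ν => ‖ν‖ ^ p).sum ≤ c →
        Real.log ‖(((T : X →ₗ[ℂ] X).restrict hW).charpoly.roots.map (modFactor m N)).prod‖ ≤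
          N * (Γ * b + δ) := by
  classical
  obtain ⟨N₀, hN₀⟩ := exists_sum_corrTerm_le hm hp hpm
    (ne_top_of_le_ne_top ENNReal.ofReal_ne_top h) (show 0 < δ / 3 by positivity)
  refine ⟨N₀, fun N hN hN1 => ?_⟩
  set ε : ℝ := min (1 / 2) (δ / 3 / ((2 + N) * (|c| + 1))) with hε
  have hε0 : 0 < ε := by positivity
  obtain ⟨Z, hZ, hG⟩ := exists_eventually_sum_roots_le hL hε0
  have hcont : Continuous fun z : ℂ => Γ * ‖z‖ ^ p + corrTerm m N ‖z‖ :=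
    ((continuous_norm.rpow_const fun _ => Or.inr hp.le).const_mul Γ).add
      (continuous_corrTerm_norm m N)
  have hnn : ∀ z : ℂ, 0 ≤ Γ * ‖z‖ ^ p + corrTerm m N ‖z‖ := fun z =>
    add_nonneg (by positivity) (corrTerm_nonneg m N (norm_nonneg z))
  filter_upwards [hG _ hcont hnn (δ / 3) (by positivity)] with T hT W _ hW hc
  specialize hT W hW
  set s := ((T : X →ₗ[ℂ] X).restrict hW).charpoly.roots with hs
  have h1 : ∑ μ ∈ Z, algebraicMultiplicity L μ * (Γ * ‖μ‖ ^ p + corrTerm m N ‖μ‖) ≤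
      Γ * b + δ / 3 := by
    have h2 := sum_algebraicMultiplicity_le_of_eigSum_le hb h hZ
    have h3 := hN₀ N hN Z hZ
    calc _ = Γ * ∑ μ ∈ Z, algebraicMultiplicity L μ * ‖μ‖ ^ p +
          ∑ μ ∈ Z, algebraicMultiplicity L μ * corrTerm m N ‖μ‖ := by
          rw [Finset.mul_sum, ← Finset.sum_add_distrib]
          exact Finset.sum_congr rfl fun _ _ => by ring
      _ ≤ _ := by gcongr
  have h4 : ‖((s.filter fun x => ε ≤ ‖x‖).map (modFactor m N)).prod‖ ≤
      Real.exp (N * (Γ * b + δ / 3 + δ / 3)) := by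
    refine (norm_prod_map_le_exp fun z _ => norm_modFactor_le hN1 hE z).trans
      (Real.exp_le_exp.mpr ?_)
    rw [Multiset.sum_map_mul_left]
    gcongr
    linarith
  have h5 : ‖((s.filter fun x => ¬ ε ≤ ‖x‖).map (modFactor m N)).prod‖ ≤
      Real.exp (N * (δ / 3)) := by
    refine (norm_prod_map_le_exp (g := fun z => N * ((2 + N) * ε) * ‖z‖ ^ p) fun z hz => ?_).trans
      (Real.exp_le_exp.mpr ?_)
    · have := norm_modFactor_le_of_norm_le (N := N) hm hp hpm (min_le_left _ _)
        (not_le.mp (Multiset.mem_filter.mp hz).2).le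
      rwa [← mul_assoc] at this
    · rw [Multiset.sum_map_mul_left, mul_assoc]
      gcongr
      have h6 : ((s.filter fun x => ¬ ε ≤ ‖x‖).map fun ν => ‖ν‖ ^ p).sum ≤ |c| + 1 := by
        have h7 := (s.filter fun x => ε ≤ ‖x‖).sum_map_norm_rpow_nonneg p
        rw [← Multiset.filter_add_not (fun x : ℂ => ε ≤ ‖x‖) s, Multiset.map_add,
          Multiset.sum_add] at hc
        linarith [le_abs_self c]
      calc _ ≤ (2 + N) * (δ / 3 / ((2 + N) * (|c| + 1))) * (|c| + 1) := by
            have : ε ≤ δ / 3 / ((2 + N) * (|c| + 1)) := min_le_right _ _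
            gcongr
            exact Multiset.sum_map_norm_rpow_nonneg _ p
        _ = δ / 3 := by field_simp
  refine Real.log_le_of_le_exp (by positivity) (norm_nonneg _) ?_
  rw [← Multiset.filter_add_not (fun x : ℂ => ε ≤ ‖x‖) s, Multiset.map_add, Multiset.prod_add,
    norm_mul]
  calc _ ≤ Real.exp (N * (Γ * b + δ / 3 + δ / 3)) * Real.exp (N * (δ / 3)) := by gcongr
    _ = _ := by rw [← Real.exp_add]; congr 1; ring

end RootSums

section RankOne

open Metric Filter Topology

theorem exists_sub_pow_apply_eq_zero {T : X →L[ℂ] X} {μ : ℂ} {r : ℝ} (hr : 0 < r)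
    (h : closedBall μ r \ {μ} ⊆ resolventSet ℂ T)
    [FiniteDimensional ℂ (LinearMap.range (rieszProjection T μ r : X →ₗ[ℂ] X))] {x : X}
    (hx : x ∈ LinearMap.range (rieszProjection T μ r : X →ₗ[ℂ] X)) :
    ∃ k : ℕ, (((T : X →ₗ[ℂ] X) - μ • (1 : Module.End ℂ X)) ^ k) x = 0 := by
  set V := LinearMap.range (rieszProjection T μ r : X →ₗ[ℂ] X) with hV
  set f : Module.End ℂ V := (T : X →ₗ[ℂ] X).restrict fun _ hv =>
      mapsTo_range_rieszProjection hr (sphere_subset_of_punctured hr h) hv with hf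
  have hmem : (⟨x, hx⟩ : V) ∈ f.maxGenEigenspace μ := by
    rw [hf, maxGenEigenspace_restrict_range_rieszProjection hr h]
    trivial
  obtain ⟨k, hk⟩ := (f.mem_maxGenEigenspace μ _).mp hmem
  refine ⟨k, ?_⟩
  have hcoe : ∀ (k : ℕ) (y : V), (((f - μ • (1 : Module.End ℂ V)) ^ k) y : X) =
      (((T : X →ₗ[ℂ] X) - μ • (1 : Module.End ℂ X)) ^ k) (y : X) := by
    intro k
    induction k with
    | zero => intro y; rfl
    | succ k ih => intro y; rw [pow_succ, pow_succ]; exact ih _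
  have := hcoe k ⟨x, hx⟩
  rw [hk] at this
  exact this.symm

theorem mem_of_sub_pow_apply_mem {T : X →ₗ[ℂ] X} {μ : ℂ} (hμ : μ ≠ 0) {S : Submodule ℂ X}
    (hS : ∀ x, T x ∈ S) (k : ℕ) {x : X} (hx : ((T - μ • (1 : Module.End ℂ X)) ^ k) x ∈ S) :
    x ∈ S := by
  induction k generalizing x with
  | zero => exact hx
  | succ k ih =>
    rw [pow_succ] at hx
    have h1 : T x - μ • x ∈ S := ih hx
    have h2 : μ • x ∈ S := by
      have := S.sub_mem (hS x) h1
      rwa [sub_sub_cancel] at this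
    exact (S.smul_mem_iff hμ).mp h2

theorem algebraicMultiplicity_eq_zero_or (T : X →L[ℂ] X) (μ : ℂ) :
    algebraicMultiplicity T μ = 0 ∨ ∃ r, 0 < r ∧ closedBall μ r \ {μ} ⊆ resolventSet ℂ T ∧
      FiniteDimensional ℂ (LinearMap.range (rieszProjection T μ r : X →ₗ[ℂ] X)) ∧
      algebraicMultiplicity T μ =
        Module.finrank ℂ (LinearMap.range (rieszProjection T μ r : X →ₗ[ℂ] X)) := by
  by_cases h : ∃ r, 0 < r ∧ ∀ z ∈ closedBall μ r, z ≠ μ → z ∉ spectrum ℂ T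
  · obtain ⟨r, hr, hsub, hm⟩ := exists_radius_of_isolated h
    by_cases hfd : FiniteDimensional ℂ (LinearMap.range (rieszProjection T μ r : X →ₗ[ℂ] X))
    · exact Or.inr ⟨r, hr, hsub, hfd, hm⟩
    · left
      rw [hm]
      exact Module.finrank_of_not_finite hfd
  · left
    rw [algebraicMultiplicity, dif_neg h]

theorem eigSum_smul_rankOne_le {p : ℝ} (hp : 0 < p) {P : X →L[ℂ] X} {v : X} (hPv : P v = v)
    (hP : ∀ x, P x ∈ Submodule.span ℂ {v}) (z : ℂ) :
    eigSum p (z • P) ≤ ENNReal.ofReal (‖z‖ ^ p) := by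
  have hTS : ∀ x, ((z • P : X →L[ℂ] X) : X →ₗ[ℂ] X) x ∈ Submodule.span ℂ {v} := fun x =>
    Submodule.smul_mem _ z (hP x)
  have hbound : ∀ μ : ℂ, μ ≠ 0 → algebraicMultiplicity (z • P) μ ≤ if μ = z then 1 else 0 := by
    intro μ hμ
    rcases algebraicMultiplicity_eq_zero_or (z • P) μ with h0 | ⟨r, hr, hsub, hfd, hm⟩
    · rw [h0]; exact Nat.zero_le _
    have hle : LinearMap.range (rieszProjection (z • P) μ r : X →ₗ[ℂ] X) ≤
        Submodule.span ℂ {v} := by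
      intro x hx
      obtain ⟨k, hk⟩ := exists_sub_pow_apply_eq_zero hr hsub hx
      exact mem_of_sub_pow_apply_mem hμ hTS k (by rw [hk]; exact Submodule.zero_mem _)
    rw [hm]
    split_ifs with hz
    · exact (Submodule.finrank_mono hle).trans
        ((finrank_span_le_card _).trans (by simp))
    · have : LinearMap.range (rieszProjection (z • P) μ r : X →ₗ[ℂ] X) = ⊥ := by
        rw [eq_bot_iff]
        intro x hx
        obtain ⟨k, hk⟩ := exists_sub_pow_apply_eq_zero hr hsub hx
        obtain ⟨c, rfl⟩ := Submodule.mem_span_singleton.mp (hle hx)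
        have hpow : ∀ k : ℕ, ((((z • P : X →L[ℂ] X) : X →ₗ[ℂ] X) -
            μ • (1 : Module.End ℂ X)) ^ k) (c • v) = (z - μ) ^ k • c • v := by
          intro k
          induction k with
          | zero => simp
          | succ k ih =>
            rw [pow_succ']
            show (((z • P : X →L[ℂ] X) : X →ₗ[ℂ] X) - μ • (1 : Module.End ℂ X))
              (((((z • P : X →L[ℂ] X) : X →ₗ[ℂ] X) - μ • (1 : Module.End ℂ X)) ^ k) (c • v)) = _
            rw [ih]
            simp only [LinearMap.sub_apply, LinearMap.smul_apply, map_smul, Module.End.one_apply]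
            show (z - μ) ^ k • c • (z • P v - μ • v) = _
            rw [hPv]
            module
        rw [hpow, smul_eq_zero] at hk
        exact hk.resolve_left (pow_ne_zero _ (sub_ne_zero.mpr (Ne.symm hz)))
      rw [this, finrank_bot]
  unfold eigSum
  have hzero : ∀ μ : {μ : ℂ // IsDiscreteEigenvalue (z • P) μ}, (μ : ℂ) ≠ z →
      (algebraicMultiplicity (z • P) (μ : ℂ) : ENNReal) * ENNReal.ofReal (‖(μ : ℂ)‖ ^ p) = 0 := by
    intro μ hμ
    by_cases h0 : (μ : ℂ) = 0
    · simp [h0, Real.zero_rpow hp.ne']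
    · have := hbound μ h0
      rw [if_neg hμ, Nat.le_zero] at this
      simp [this]
  by_cases hz : IsDiscreteEigenvalue (z • P) z
  · rw [tsum_eq_single ⟨z, hz⟩ fun μ hμ => hzero μ fun h => hμ (Subtype.ext h)]
    by_cases h0 : z = 0
    · simp [h0, Real.zero_rpow hp.ne']
    · have := hbound z h0
      rw [if_pos rfl] at this
      calc _ ≤ (1 : ENNReal) * ENNReal.ofReal (‖z‖ ^ p) := by
            gcongr
            exact_mod_cast this
        _ = _ := one_mul _
  · have : ∀ μ : {μ : ℂ // IsDiscreteEigenvalue (z • P) μ},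
        (algebraicMultiplicity (z • P) (μ : ℂ) : ENNReal) * ENNReal.ofReal (‖(μ : ℂ)‖ ^ p) = 0 :=
      fun μ => hzero μ fun h => hz ((congrArg (IsDiscreteEigenvalue (z • P)) h).mp μ.2)
    simp only [this, tsum_zero]
    exact zero_le

theorem range_smul_rankOne {P : X →L[ℂ] X} {v : X} (hPv : P v = v)
    (hP : ∀ x, P x ∈ Submodule.span ℂ {v}) {z : ℂ} (hz : z ≠ 0) :
    LinearMap.range ((z • P : X →L[ℂ] X) : X →ₗ[ℂ] X) = Submodule.span ℂ {v} := by
  refine le_antisymm ?_ ?_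
  · rintro _ ⟨x, rfl⟩
    exact Submodule.smul_mem _ z (hP x)
  · rw [Submodule.span_singleton_le_iff_mem]
    refine ⟨z⁻¹ • v, ?_⟩
    show z • P (z⁻¹ • v) = v
    rw [map_smul, hPv, smul_smul, mul_inv_cancel₀ hz, one_smul]

theorem restrict_range_smul_rankOne {P : X →L[ℂ] X} {v : X} (hPv : P v = v)
    (hP : ∀ x, P x ∈ Submodule.span ℂ {v}) {z : ℂ} (hz : z ≠ 0) :
    (((z • P : X →L[ℂ] X) : X →ₗ[ℂ] X).restrict fun x _ => LinearMap.mem_range_self _ x :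
      LinearMap.range ((z • P : X →L[ℂ] X) : X →ₗ[ℂ] X) →ₗ[ℂ]
        LinearMap.range ((z • P : X →L[ℂ] X) : X →ₗ[ℂ] X)) = z • LinearMap.id := by
  ext ⟨x, hx⟩
  rw [range_smul_rankOne hPv hP hz] at hx
  obtain ⟨c, rfl⟩ := Submodule.mem_span_singleton.mp hx
  show z • P (c • v) = z • c • v
  rw [map_smul, hPv]

theorem finrank_range_smul_rankOne {P : X →L[ℂ] X} {v : X} (hv : v ≠ 0) (hPv : P v = v)
    (hP : ∀ x, P x ∈ Submodule.span ℂ {v}) {z : ℂ} (hz : z ≠ 0) :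
    Module.finrank ℂ (LinearMap.range ((z • P : X →L[ℂ] X) : X →ₗ[ℂ] X)) = 1 := by
  rw [range_smul_rankOne hPv hP hz, finrank_span_singleton hv]

theorem detp_smul_rankOne {P : X →L[ℂ] X} {v : X} (hv : v ≠ 0) (hPv : P v = v)
    (hP : ∀ x, P x ∈ Submodule.span ℂ {v}) {z : ℂ} (hz : z ≠ 0) (p : ℝ) :
    detp p (z • P) =
      (1 - z) * Complex.exp (∑ j ∈ Finset.Icc 1 (⌈p⌉₊ - 1), z ^ j / (j : ℂ)) := by
  have hidem : P * P = P := by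
    ext x
    obtain ⟨c, hc⟩ := Submodule.mem_span_singleton.mp (hP x)
    show P (P x) = P x
    rw [← hc, map_smul, hPv]
  have hpow : ∀ k : ℕ, 1 ≤ k → (z • P) ^ k = z ^ k • P := by
    intro k hk
    rw [smul_pow, (show IsIdempotentElem P from hidem).pow_eq (by omega)]
  unfold detp detOneSub
  rw [restrict_range_smul_rankOne hPv hP hz]
  congr 1
  · have : (LinearMap.id : LinearMap.range ((z • P : X →L[ℂ] X) : X →ₗ[ℂ] X) →ₗ[ℂ] _) -
        z • LinearMap.id = (1 - z) • LinearMap.id := by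
      refine LinearMap.ext fun x => ?_
      show x - z • x = (1 - z) • x
      rw [sub_smul, one_smul]
    rw [this, LinearMap.det_smul, LinearMap.det_id, finrank_range_smul_rankOne hv hPv hP hz]
    simp
  · congr 1
    refine Finset.sum_congr rfl fun k hk => ?_
    congr 1
    have hk1 := (Finset.mem_Icc.mp hk).1
    rw [hpow k hk1]
    have hzk : z ^ k ≠ 0 := pow_ne_zero k hz
    have : FiniteDimensional ℂ (LinearMap.range ((z ^ k • P : X →L[ℂ] X) : X →ₗ[ℂ] X)) := by
      rw [range_smul_rankOne hPv hP hzk]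
      infer_instance
    unfold trOn
    rw [restrict_range_smul_rankOne hPv hP hzk, map_smul, LinearMap.trace_id,
      finrank_range_smul_rankOne hv hPv hP hzk]
    simp

theorem norm_elementaryFactor_le_of_detp_le [Nontrivial X] {p Γ : ℝ} (hp : 0 < p) (hΓ : 0 ≤ Γ)
    (hΓb : ∀ F : X →L[ℂ] X, IsFiniteRank F →
      ‖detp p F‖ ≤ Real.exp (Γ * (eigSum p F).toReal)) (z : ℂ) :
    ‖(1 - z) * Complex.exp (∑ j ∈ Finset.Icc 1 (⌈p⌉₊ - 1), z ^ j / (j : ℂ))‖ ≤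
      Real.exp (Γ * ‖z‖ ^ p) := by
  by_cases hz : z = 0
  · subst hz
    have : ∑ j ∈ Finset.Icc 1 (⌈p⌉₊ - 1), (0 : ℂ) ^ j / (j : ℂ) = 0 :=
      Finset.sum_eq_zero fun j hj => by
        rw [zero_pow (by have := (Finset.mem_Icc.mp hj).1; omega), zero_div]
    simp [this, Real.zero_rpow hp.ne']
  obtain ⟨v, hv⟩ := exists_ne (0 : X)
  obtain ⟨f, -, hf⟩ := exists_dual_vector ℂ v (norm_ne_zero_iff.mpr hv)
  let P : X →L[ℂ] X := f.smulRight ((‖v‖ : ℂ)⁻¹ • v)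
  have hn : (‖v‖ : ℂ) ≠ 0 := by exact_mod_cast norm_ne_zero_iff.mpr hv
  have hPv : P v = v := by
    show f v • (‖v‖ : ℂ)⁻¹ • v = v
    rw [hf, smul_smul]
    exact (congrArg (· • v) (mul_inv_cancel₀ hn)).trans (one_smul _ _)
  have hP : ∀ x, P x ∈ Submodule.span ℂ {v} := fun x =>
    Submodule.smul_mem _ _ (Submodule.smul_mem _ _ (Submodule.mem_span_singleton_self v))
  rw [← detp_smul_rankOne hv hPv hP hz]
  have hfr : IsFiniteRank (z • P) := by
    unfold IsFiniteRank
    rw [range_smul_rankOne hPv hP hz]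
    infer_instance
  refine (hΓb _ hfr).trans (Real.exp_le_exp.mpr ?_)
  gcongr
  exact ENNReal.toReal_le_of_le_ofReal (by positivity) (eigSum_smul_rankOne_le hp hPv hP z)

end RankOne

section ReciprocalResolvent

open Filter Topology

/-- The resolvent at `w⁻¹`, extended to `w = 0` by the value `0`. -/
noncomputable def reciprocalResolvent (A : X →L[ℂ] X) (w : ℂ) : X →L[ℂ] X :=
  w • Ring.inverse (1 - w • A)

@[simp]
theorem reciprocalResolvent_zero (A : X →L[ℂ] X) : reciprocalResolvent A 0 = 0 := zero_smul _ _

theorem differentiableAt_reciprocalResolvent {A : X →L[ℂ] X} {w : ℂ} (h : IsUnit (1 - w • A)) :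
    DifferentiableAt ℂ (reciprocalResolvent A) w := by
  have h1 : DifferentiableAt ℂ (Ring.inverse : (X →L[ℂ] X) → _) (1 - w • A) :=
    differentiableAt_inverse h
  have h3 : DifferentiableAt ℂ (fun w : ℂ => 1 - w • A) w := by fun_prop
  have h2 : DifferentiableAt ℂ (fun w : ℂ => Ring.inverse (1 - w • A)) w :=
    DifferentiableAt.comp (g := Ring.inverse) (f := fun w : ℂ => 1 - w • A) w h1 h3
  exact differentiableAt_fun_id.fun_smul h2

theorem reciprocalResolvent_apply_sub {A : X →L[ℂ] X} {w : ℂ} (h : IsUnit (1 - w • A)) (x : X) :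
    reciprocalResolvent A w (x - w • A x) = w • x := by
  have := congrArg (fun S : X →L[ℂ] X => w • S x) (Ring.inverse_mul_cancel _ h)
  simpa [reciprocalResolvent] using this

theorem isUnit_one_sub_smul_iff {A : X →L[ℂ] X} {w : ℂ} (hw : w ≠ 0) :
    IsUnit (1 - w • A) ↔ w⁻¹ ∈ resolventSet ℂ A := by
  rw [spectrum.mem_resolventSet_iff, Algebra.algebraMap_eq_smul_one]
  have : w⁻¹ • (1 : X →L[ℂ] X) - A = (Units.mk0 w hw)⁻¹ • (1 - w • A) := by
    rw [Units.smul_def, Units.val_inv_eq_inv_val, Units.val_mk0, smul_sub, smul_smul,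
      inv_mul_cancel₀ hw, one_smul]
  rw [this]
  exact (isUnit_smul_iff _ _).symm

theorem reciprocalResolvent_eq_resolvent {A : X →L[ℂ] X} {w : ℂ} (hw : w ≠ 0) :
    reciprocalResolvent A w = resolvent A w⁻¹ := by
  have := spectrum.units_smul_resolvent (r := (Units.mk0 w hw)⁻¹) (s := w⁻¹) (a := A)
  have h2 : w⁻¹ • resolvent A w⁻¹ = Ring.inverse (1 - w • A) := by
    rw [Units.smul_def, Units.val_inv_eq_inv_val, Units.val_mk0] at this
    rw [this, resolvent, Units.smul_def, inv_inv, Units.val_mk0]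
    simp [hw]
  rw [reciprocalResolvent, ← h2, smul_smul, mul_inv_cancel₀ hw, one_smul]

theorem finrank_le_analyticOrderAt_det_compressionMatrix {A K : X →L[ℂ] X}
    {W V : Submodule ℂ X} [FiniteDimensional ℂ W] (hVW : V ≤ W) {F : X →L[ℂ] W}
    (hFK : ∀ v ∈ V, (F v : X) = K v) (hV : ∀ v ∈ V, ((A + K : X →L[ℂ] X) : X →ₗ[ℂ] X) v ∈ V)
    {μ w₀ : ℂ}
    (hT : Module.End.maxGenEigenspace (((A + K : X →L[ℂ] X) : X →ₗ[ℂ] X).restrict hV) μ = ⊤)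
    (hw : w₀ * μ = 1) (hu : ∀ᶠ w in 𝓝 w₀, IsUnit (1 - w • A)) :
    (Module.finrank ℂ V : ℕ∞) ≤ analyticOrderAt
      (fun w => (1 - compressionMatrix F (reciprocalResolvent A w)).det) w₀ := by
  have : FiniteDimensional ℂ V := Submodule.finiteDimensional_of_le hVW
  simp only [det_one_sub_compressionMatrix]
  set ι : V →ₗ[ℂ] W := Submodule.inclusion hVW with hι
  set T : Module.End ℂ V := ((A + K : X →L[ℂ] X) : X →ₗ[ℂ] X).restrict hV with hTdef
  set F' : V →ₗ[ℂ] W := (F : X →ₗ[ℂ] W) ∘ₗ V.subtype with hF'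
  have hJcoe : ∀ (w : ℂ) (v : V), ((ι ((1 - w • T) v) + w • F' v : W) : X) = v - w • A v := by
    intro w v
    have h1 : ((F' v : W) : X) = K v := hFK v v.2
    have h2 : ((ι ((1 - w • T) v) : W) : X) = v - w • (A v + K v) := rfl
    rw [Submodule.coe_add, Submodule.coe_smul, h1, h2, smul_add]
    abel
  refine finrank_le_analyticOrderAt_det
    (D := fun w => LinearMap.id - (F : X →ₗ[ℂ] W) ∘ₗ (reciprocalResolvent A w : X →ₗ[ℂ] X) ∘ₗ
      W.subtype) (J := fun w => ι ∘ₗ (1 - w • T) + w • F') (ι := ι)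
    (Submodule.inclusion_injective hVW) hT hw ?_ ?_ ?_ ?_
  · rw [injective_iff_map_eq_zero]
    intro v hv
    have h1 : (v : X) - w₀ • A v = 0 := by
      rw [← hJcoe, ← Submodule.coe_zero (p := W), ← hv]
      rfl
    have hinj := (ContinuousLinearMap.isUnit_iff_bijective.mp hu.self_of_nhds).1
    have : (v : X) = 0 := hinj (by simpa using h1)
    exact Subtype.ext this
  · intro x l
    rw [Complex.analyticAt_iff_eventually_differentiableAt]
    filter_upwards [hu] with w hw
    have h1 := differentiableAt_reciprocalResolvent hw
    have : (fun w => l ((LinearMap.id - (F : X →ₗ[ℂ] W) ∘ₗ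
        (reciprocalResolvent A w : X →ₗ[ℂ] X) ∘ₗ W.subtype : W →ₗ[ℂ] W) x)) = fun w =>
        LinearMap.toContinuousLinearMap l (x - F (reciprocalResolvent A w (x : X))) := rfl
    rw [this]
    fun_prop
  · intro v l
    rw [Complex.analyticAt_iff_eventually_differentiableAt]
    refine Eventually.of_forall fun w => ?_
    have : (fun w => l ((ι ∘ₗ (1 - w • T) + w • F' : V →ₗ[ℂ] W) v)) = fun w =>
        l (ι v) - w * l (ι (T v)) + w * l (F' v) := by
      ext w
      simp [sub_eq_add_neg]
    rw [this]
    fun_prop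
  · filter_upwards [hu] with w hw v
    have h1 : ((LinearMap.id - (F : X →ₗ[ℂ] W) ∘ₗ
        (reciprocalResolvent A w : X →ₗ[ℂ] X) ∘ₗ W.subtype : W →ₗ[ℂ] W)
          ((ι ∘ₗ (1 - w • T) + w • F' : V →ₗ[ℂ] W) v)) =
        ι ((1 - w • T) v) + w • F' v -
          F (reciprocalResolvent A w ((ι ((1 - w • T) v) + w • F' v : W) : X)) := rfl
    rw [h1, hJcoe, reciprocalResolvent_apply_sub hw, map_smul]
    exact add_sub_cancel_right _ _

end ReciprocalResolvent

section ModDet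

open Filter Topology

variable {k m N : ℕ}

theorem modDet_zero (hm : m ≠ 0) : modDet m N (0 : Matrix (Fin k) (Fin k) ℂ) = 1 := by
  have h : ∑ j ∈ Finset.Icc 1 (m - 1), ((0 : Matrix (Fin k) (Fin k) ℂ) ^ j).trace / (j : ℂ) = 0 :=
    Finset.sum_eq_zero fun j hj => by
      rw [zero_pow (Nat.one_le_iff_ne_zero.mp (Finset.mem_Icc.mp hj).1), Matrix.trace_zero, zero_div]
  simp [_root_.modDet, h, hm]

theorem DifferentiableAt.modDet {M : ℂ → Matrix (Fin k) (Fin k) ℂ} {w : ℂ}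
    (hM : ∀ i j, DifferentiableAt ℂ (fun w => M w i j) w) :
    DifferentiableAt ℂ (fun w => modDet m N (M w)) w := by
  have h1 : ∀ i j, DifferentiableAt ℂ (fun w => (1 - M w) i j) w := fun i j =>
    (differentiableAt_const _).sub (hM i j)
  have h2 : ∀ i j, DifferentiableAt ℂ (fun w => (1 + (N / m : ℂ) • M w ^ m) i j) w := fun i j =>
    (differentiableAt_const _).add ((DifferentiableAt.matrix_pow hM m i j).const_smul (N / m : ℂ))
  refine (((DifferentiableAt.matrix_det h1).mul
    (DifferentiableAt.fun_sum fun j _ => ?_).cexp).pow N).mul (DifferentiableAt.matrix_det h2)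
  exact (DifferentiableAt.matrix_trace (DifferentiableAt.matrix_pow hM j)).div_const _

theorem mul_le_analyticOrderAt_modDet {M : ℂ → Matrix (Fin k) (Fin k) ℂ} {w₀ : ℂ}
    (hM : ∀ᶠ w in 𝓝 w₀, ∀ i j, DifferentiableAt ℂ (fun w => M w i j) w) {d : ℕ}
    (hd : (d : ℕ∞) ≤ analyticOrderAt (fun w => (1 - M w).det) w₀) :
    ((N * d : ℕ) : ℕ∞) ≤ analyticOrderAt (fun w => modDet m N (M w)) w₀ := by
  have a1 : AnalyticAt ℂ (fun w => (1 - M w).det) w₀ := by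
    rw [Complex.analyticAt_iff_eventually_differentiableAt]
    filter_upwards [hM] with w hw
    exact DifferentiableAt.matrix_det fun i j => (differentiableAt_const _).sub (hw i j)
  have a2 : AnalyticAt ℂ
      (fun w => Complex.exp (∑ j ∈ Finset.Icc 1 (m - 1), (M w ^ j).trace / (j : ℂ))) w₀ := by
    rw [Complex.analyticAt_iff_eventually_differentiableAt]
    filter_upwards [hM] with w hw
    exact (DifferentiableAt.fun_sum fun j _ =>
      (DifferentiableAt.matrix_trace (DifferentiableAt.matrix_pow hw j)).div_const _).cexp
  have a3 : AnalyticAt ℂ (fun w => (1 + (N / m : ℂ) • M w ^ m).det) w₀ := by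
    rw [Complex.analyticAt_iff_eventually_differentiableAt]
    filter_upwards [hM] with w hw
    exact DifferentiableAt.matrix_det fun i j =>
      (differentiableAt_const _).add ((DifferentiableAt.matrix_pow hw m i j).const_smul (N / m : ℂ))
  have h := analyticOrderAt_mul ((a1.mul a2).pow N) a3
  rw [analyticOrderAt_pow (a1.mul a2), analyticOrderAt_mul a1 a2] at h
  calc ((N * d : ℕ) : ℕ∞) = N • (d : ℕ∞) := by simp
    _ ≤ N • (analyticOrderAt (fun w => (1 - M w).det) w₀ + analyticOrderAt (fun w => Complex.exp
        (∑ j ∈ Finset.Icc 1 (m - 1), (M w ^ j).trace / (j : ℂ))) w₀) :=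
      nsmul_le_nsmul_right (hd.trans le_self_add) N
    _ ≤ _ := le_self_add
    _ = _ := h.symm

end ModDet

section Ideal

open Filter Topology

namespace LpIdeal

variable {p : ℝ} (I : LpIdeal p X)

theorem sub_mem {K L : X →L[ℂ] X} (hK : K ∈ I.carrier) (hL : L ∈ I.carrier) :
    K - L ∈ I.carrier := by
  have := I.add_mem hK (I.smul_mem (-1) hL)
  rwa [neg_one_smul, ← sub_eq_add_neg] at this

theorem mul_right_mem {L : X →L[ℂ] X} (hL : L ∈ I.carrier) (B : X →L[ℂ] X) :
    L * B ∈ I.carrier := by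
  simpa using I.mul_mem L hL 1 B

theorem norm'_mul_le {L : X →L[ℂ] X} (hL : L ∈ I.carrier) (B : X →L[ℂ] X) :
    I.norm' (L * B) ≤ I.norm' L * ‖B‖ := by
  have h := I.mul_norm'_le L hL 1 B
  rw [one_mul] at h
  refine h.trans (mul_le_mul_of_nonneg_right ?_ (norm_nonneg _))
  exact mul_le_of_le_one_left (I.norm'_nonneg L hL) ContinuousLinearMap.norm_id_le

theorem exists_norm_sub_lt {L : X →L[ℂ] X} (hL : L ∈ I.carrier) {ε : ℝ} (hε : 0 < ε) :
    ∃ F, IsFiniteRank F ∧ ‖L - F‖ < ε := by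
  obtain ⟨F, hF, h⟩ := I.dense_finiteRank L hL ε hε
  exact ⟨F, hF, (I.opNorm_le _ (I.sub_mem hL (I.finiteRank_mem F hF))).trans_lt h⟩

theorem eigSum_mul_le (hp : 0 < p) {L B : X →L[ℂ] X} (hL : L ∈ I.carrier) {c M : ℝ}
    (hc : I.norm' L ≤ c) (hM : ‖B‖ ≤ M) :
    eigSum p (L * B) ≤ ENNReal.ofReal ((I.γ * (c * M)) ^ p) := by
  have h0 := I.norm'_nonneg L hL
  have h1 := I.norm'_nonneg _ (I.mul_right_mem hL B)
  refine (I.eig_le _ (I.mul_right_mem hL B)).trans (ENNReal.ofReal_le_ofReal ?_)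
  refine Real.rpow_le_rpow (mul_nonneg I.γ_nonneg h1) ?_ hp.le
  refine mul_le_mul_of_nonneg_left ((I.norm'_mul_le hL B).trans ?_) I.γ_nonneg
  exact mul_le_mul hc hM (norm_nonneg _) (h0.trans hc)

/-- Approximation by finite rank operators that agree with the given operator on a prescribed
finite-dimensional subspace. -/
theorem exists_seq_tendsto_eqOn {K : X →L[ℂ] X} (hK : K ∈ I.carrier) (V : Submodule ℂ X)
    [FiniteDimensional ℂ V] : ∃ (F : ℕ → X →L[ℂ] X) (c : ℝ), (∀ n, IsFiniteRank (F n)) ∧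
      (∀ n, ∀ v ∈ V, F n v = K v) ∧ Tendsto F atTop (𝓝 K) ∧ ∀ n, I.norm' (F n) ≤ c := by
  obtain ⟨P, hP⟩ := Submodule.ClosedComplemented.of_finiteDimensional (𝕜 := ℂ) V
  set Q : X →L[ℂ] X := V.subtypeL ∘L P with hQ
  have hQV : ∀ v ∈ V, Q v = v := fun v hv => congrArg Subtype.val (hP ⟨v, hv⟩)
  choose F hF hFK using fun n : ℕ => I.dense_finiteRank K hK (1 / (n + 1)) (by positivity)
  have hQf : FiniteDimensional ℂ (LinearMap.range (Q : X →ₗ[ℂ] X)) :=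
    Submodule.finiteDimensional_of_le (S₂ := V) (by rintro _ ⟨x, rfl⟩; exact (P x).2)
  have hF' : ∀ n, IsFiniteRank (F n + (K - F n) * Q) := by
    intro n
    have h1 : FiniteDimensional ℂ (LinearMap.range (F n : X →ₗ[ℂ] X)) := hF n
    refine Submodule.finiteDimensional_of_le (S₂ := LinearMap.range (F n : X →ₗ[ℂ] X) ⊔
      (LinearMap.range (Q : X →ₗ[ℂ] X)).map ((K - F n : X →L[ℂ] X) : X →ₗ[ℂ] X)) ?_
    rintro _ ⟨x, rfl⟩
    exact Submodule.add_mem_sup ⟨x, rfl⟩ ⟨Q x, ⟨x, rfl⟩, rfl⟩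
  have hmem : ∀ n, K - F n ∈ I.carrier := fun n => I.sub_mem hK (I.finiteRank_mem _ (hF n))
  have hsub : ∀ n, F n + (K - F n) * Q - K = (K - F n) * (Q - 1) := by
    intro n
    rw [mul_sub, mul_one]
    abel
  have hsm : ∀ n, F n + (K - F n) * Q - K ∈ I.carrier := fun n =>
    I.sub_mem (I.finiteRank_mem _ (hF' n)) hK
  have hle : ∀ n : ℕ, I.norm' (F n + (K - F n) * Q - K) ≤ 1 / (n + 1) * ‖Q - 1‖ := fun n => by
    rw [hsub]
    exact (I.norm'_mul_le (hmem n) _).trans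
      (mul_le_mul_of_nonneg_right (hFK n).le (norm_nonneg _))
  refine ⟨fun n => F n + (K - F n) * Q, I.q * (‖Q - 1‖ + I.norm' K), hF', ?_, ?_, ?_⟩
  · intro n v hv
    simp [hQV v hv]
  · rw [tendsto_iff_norm_sub_tendsto_zero]
    refine squeeze_zero (fun _ => norm_nonneg _)
      (fun n => (I.opNorm_le _ (hsm n)).trans (hle n)) ?_
    simpa using tendsto_one_div_add_atTop_nhds_zero_nat.mul_const ‖Q - 1‖
  · intro n
    have h := I.norm'_add_le _ (hsm n) K hK
    rw [sub_add_cancel] at h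
    refine h.trans (mul_le_mul_of_nonneg_left ?_ (zero_le_one.trans I.one_le_q))
    have h1 : 1 / ((n : ℝ) + 1) ≤ 1 := by
      rw [div_le_one (by positivity)]
      linarith [Nat.cast_nonneg (α := ℝ) n]
    have := (hle n).trans (mul_le_of_le_one_left (norm_nonneg _) h1)
    linarith

end LpIdeal

end Ideal

section InvariantSubspace

open Metric

theorem exists_invariant_finrank_eq_algebraicMultiplicity (T : X →L[ℂ] X) (μ : ℂ) :
    ∃ (V : Submodule ℂ X) (hV : ∀ v ∈ V, (T : X →ₗ[ℂ] X) v ∈ V), FiniteDimensional ℂ V ∧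
      Module.End.maxGenEigenspace ((T : X →ₗ[ℂ] X).restrict hV) μ = ⊤ ∧
      algebraicMultiplicity T μ = Module.finrank ℂ V := by
  rcases algebraicMultiplicity_eq_zero_or T μ with h | ⟨r, hr, hsub, hfd, h⟩
  · refine ⟨⊥, fun v hv => ?_, inferInstance, Subsingleton.elim _ _, by simp [h]⟩
    rw [(Submodule.mem_bot ℂ).mp hv, map_zero]
    exact Submodule.zero_mem _
  · exact ⟨_, _, hfd, maxGenEigenspace_restrict_range_rieszProjection hr hsub, h⟩

end InvariantSubspace

section Jensen

open Metric Filter Topology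

variable {A : X →L[ℂ] X} {W : Submodule ℂ X} [FiniteDimensional ℂ W] {m N : ℕ} {ρ : ℝ}

theorem modDet_compressionMatrix (F : X →L[ℂ] W) (G : X →L[ℂ] X)
    (hW : ∀ x ∈ W, (((W.subtypeL ∘L F) * G : X →L[ℂ] X) : X →ₗ[ℂ] X) x ∈ W) :
    modDet m N (compressionMatrix F G) = (((((W.subtypeL ∘L F) * G : X →L[ℂ] X) :
      X →ₗ[ℂ] X).restrict hW).charpoly.roots.map (modFactor m N)).prod := by
  rw [modDet_eq_prod, compressionMatrix, LinearMap.charpoly_toMatrix]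
  rfl

theorem analyticOnNhd_modDet_compressionMatrix (F : X →L[ℂ] W)
    (hA : ∀ w ∈ closedBall (0 : ℂ) ρ, IsUnit (1 - w • A)) :
    AnalyticOnNhd ℂ (fun w => modDet m N (compressionMatrix F (reciprocalResolvent A w)))
      (closedBall 0 ρ) := by
  intro w hw
  have ho : ∀ᶠ w : ℂ in 𝓝 w, IsUnit (1 - w • A) :=
    (continuous_const.sub (continuous_id.smul continuous_const)).continuousAt.eventually
      (Units.isOpen.mem_nhds (hA w hw))
  rw [Complex.analyticAt_iff_eventually_differentiableAt]
  filter_upwards [ho] with w hw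
  exact DifferentiableAt.modDet
    (differentiableAt_compressionMatrix F (differentiableAt_reciprocalResolvent hw))

theorem sum_mul_log_le_circleAverage_modDet (F : X →L[ℂ] W) (hρ : 0 < ρ) (hm : m ≠ 0)
    (hA : ∀ w ∈ closedBall (0 : ℂ) ρ, IsUnit (1 - w • A)) (S : Finset ℂ) (d : ℂ → ℕ)
    (hS : ∀ μ ∈ S, ‖μ‖⁻¹ ≤ ρ)
    (hd : ∀ μ ∈ S, (d μ : ℕ∞) ≤ analyticOrderAt
      (fun w => (1 - compressionMatrix F (reciprocalResolvent A w)).det) μ⁻¹) :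
    N * ∑ μ ∈ S, d μ * Real.log (ρ * ‖μ‖) ≤ Real.circleAverage (fun w =>
      Real.log ‖modDet m N (compressionMatrix F (reciprocalResolvent A w))‖) 0 ρ := by
  classical
  have h := (analyticOnNhd_modDet_compressionMatrix (m := m) (N := N) F
    hA).sum_mul_log_le_circleAverage hρ ?_ (S.image (·⁻¹)) (fun z => N * d z⁻¹) ?_ ?_
  · rw [Finset.sum_image inv_injective.injOn] at h
    refine le_of_eq_of_le ?_ h
    rw [Finset.mul_sum]
    refine Finset.sum_congr rfl fun μ _ => ?_
    rw [norm_inv, inv_inv, inv_inv]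
    push_cast
    ring
  · have : compressionMatrix F (0 : X →L[ℂ] X) = 0 := by simp [compressionMatrix]
    simp only [reciprocalResolvent_zero, this]
    exact modDet_zero hm
  · simpa using hS
  · simp only [Finset.mem_image]
    rintro _ ⟨μ, hμ, rfl⟩
    rw [inv_inv]
    refine mul_le_analyticOrderAt_modDet ?_ (hd μ hμ)
    have h0 : μ⁻¹ ∈ closedBall (0 : ℂ) ρ := by simpa using hS μ hμ
    have ho : ∀ᶠ w : ℂ in 𝓝 μ⁻¹, IsUnit (1 - w • A) :=
      (continuous_const.sub (continuous_id.smul continuous_const)).continuousAt.eventually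
        (Units.isOpen.mem_nhds (hA _ h0))
    filter_upwards [ho] with w hw
    exact differentiableAt_compressionMatrix F (differentiableAt_reciprocalResolvent hw)

end Jensen

section Main

open Metric Filter Topology MeasureTheory

theorem sum_algebraicMultiplicity_mul_log_le [Nontrivial X] {p Γ : ℝ} (hp : 0 < p)
    (I : LpIdeal p X) (hΓ : 0 ≤ Γ)
    (hΓb : ∀ F : X →L[ℂ] X, IsFiniteRank F →
      ‖detp p F‖ ≤ Real.exp (Γ * (eigSum p F).toReal))
    {A K : X →L[ℂ] X} (hK : K ∈ I.carrier) {ρ M : ℝ} (hρ : 0 < ρ)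
    (hA : ∀ w ∈ closedBall (0 : ℂ) ρ, IsUnit (1 - w • A))
    (hM : ∀ w ∈ sphere (0 : ℂ) ρ, ‖reciprocalResolvent A w‖ ≤ M) (S : Finset ℂ)
    (hS0 : ∀ μ ∈ S, μ ≠ 0) (hS : ∀ μ ∈ S, ‖μ‖⁻¹ ≤ ρ) :
    ∑ μ ∈ S, algebraicMultiplicity (A + K) μ * Real.log (ρ * ‖μ‖) ≤
      Γ * (I.γ * (I.norm' K * M)) ^ p := by
  choose V hV hVfd hVT hVm using exists_invariant_finrank_eq_algebraicMultiplicity (A + K)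
  obtain ⟨F, c, hF, hFV, hFK, hFc⟩ := I.exists_seq_tendsto_eqOn hK (S.sup V)
  have hFfd : ∀ n, FiniteDimensional ℂ (LinearMap.range (F n : X →ₗ[ℂ] X)) := hF
  set W : ℕ → Submodule ℂ X := fun n => LinearMap.range (F n : X →ₗ[ℂ] X) ⊔ S.sup V with hW
  set F₀ : ∀ n, X →L[ℂ] W n := fun n => (F n).codRestrict (W n) fun x =>
    Submodule.mem_sup_left ⟨x, rfl⟩ with hF₀
  set m := ⌈p⌉₊ with hm
  have hm1 : 1 ≤ m := Nat.ceil_pos.mpr hp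
  have hpm : p ≤ m := Nat.le_ceil p
  have hE := norm_elementaryFactor_le_of_detp_le hp hΓ hΓb
  set H : ℕ → ℕ → ℂ → ℂ := fun N n w =>
    modDet m (N + 1) (compressionMatrix (F₀ n) (reciprocalResolvent A w)) with hH
  have hHa : ∀ N n, AnalyticOnNhd ℂ (H N n) (closedBall 0 ρ) := fun N n =>
    analyticOnNhd_modDet_compressionMatrix (F₀ n) hA
  have hinv : ∀ n w, ∀ x ∈ W n, ((F n * reciprocalResolvent A w : X →L[ℂ] X) : X →ₗ[ℂ] X) x ∈ W n :=
    fun n w x _ => Submodule.mem_sup_left ⟨_, rfl⟩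
  have hHroots : ∀ N n w, H N n w = ((((F n * reciprocalResolvent A w : X →L[ℂ] X) :
      X →ₗ[ℂ] X).restrict (hinv n w)).charpoly.roots.map (modFactor m (N + 1))).prod :=
    fun N n w => modDet_compressionMatrix (F₀ n) _ (hinv n w)
  have hM0 : 0 ≤ M := by
    have hne : (ρ : ℂ) ∈ sphere (0 : ℂ) ρ := by simp [abs_of_pos hρ]
    exact (norm_nonneg _).trans (hM _ hne)
  have hKn := I.norm'_nonneg K hK
  have hc0 : 0 ≤ c := (I.norm'_nonneg _ (I.finiteRank_mem _ (hF 0))).trans (hFc 0)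
  have hγ := I.γ_nonneg
  have hcirc : ∀ θ, circleMap (0 : ℂ) ρ θ ∈ sphere (0 : ℂ) ρ := fun θ =>
    circleMap_mem_sphere 0 hρ.le θ
  have hroots : ∀ n θ, ((((F n * reciprocalResolvent A (circleMap 0 ρ θ) : X →L[ℂ] X) :
      X →ₗ[ℂ] X).restrict (hinv n _)).charpoly.roots.map fun ν => ‖ν‖ ^ p).sum ≤
        (I.γ * (c * M)) ^ p := fun n θ =>
    sum_roots_rpow_le hp (by positivity)
      (fun ε hε => I.exists_norm_sub_lt (I.mul_right_mem (I.finiteRank_mem _ (hF n)) _) hε)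
      (I.eigSum_mul_le hp (I.finiteRank_mem _ (hF n)) (hFc n) (hM _ (hcirc θ))) (W n) _
  set u : ℕ → ℕ → ℝ → ℝ := fun N n θ =>
    ((N : ℝ) + 1)⁻¹ * Real.log ‖H N n (circleMap 0 ρ θ)‖ with hu
  have hdiv : ∀ {N : ℕ} {a b : ℝ}, a ≤ (N + 1 : ℕ) * b → ((N : ℝ) + 1)⁻¹ * a ≤ b := by
    intro N a b h
    rw [inv_mul_le_iff₀ (by positivity)]
    exact_mod_cast h
  have hvol : (volume.restrict (Set.Ioc 0 (2 * Real.pi))).real Set.univ = 2 * Real.pi := by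
    rw [measureReal_restrict_apply_univ, Real.volume_real_Ioc_of_le (by positivity), sub_zero]
  refine le_of_le_integral_of_eventually_le (μ := volume.restrict (Set.Ioc 0 (2 * Real.pi)))
    ?_ (u := u) (c := (Γ + m / p) * (I.γ * (c * M)) ^ p) ?_ ?_ ?_ ?_ ?_
  · intro h
    rw [h, measureReal_zero_apply] at hvol
    exact Real.two_pi_pos.ne hvol
  · intro N n
    have h1 : Continuous fun θ => H N n (circleMap 0 ρ θ) :=
      (hHa N n).continuousOn.comp_continuous (continuous_circleMap 0 ρ) fun θ =>
        sphere_subset_closedBall (hcirc θ)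
    exact (Real.measurable_log.comp h1.norm.measurable).const_mul _
  · intro N n
    have h1 : CircleIntegrable (fun w => Real.log ‖H N n w‖) 0 ρ :=
      MeromorphicOn.circleIntegrable_log_norm_of_nonneg
        (fun z hz => (hHa N n z (sphere_subset_closedBall hz)).meromorphicAt) hρ.le
    exact ((intervalIntegrable_iff_integrableOn_Ioc_of_le Real.two_pi_pos.le).mp h1).const_mul _
  · intro N n θ
    refine hdiv ?_
    rw [hHroots]
    exact log_norm_prod_modFactor_le (by omega) hm1 hp hpm hΓ hE (hroots n θ)
  · intro θ δ hδ
    set B := reciprocalResolvent A (circleMap 0 ρ θ) with hB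
    have hKB := I.mul_right_mem hK B
    obtain ⟨N₀, hN₀⟩ := eventually_log_norm_prod_modFactor_le hm1 hp hpm hΓ hE
      (fun ε hε => I.exists_norm_sub_lt hKB hε) (b := (I.γ * (I.norm' K * M)) ^ p) (by positivity)
      (I.eigSum_mul_le hp hK le_rfl (hM _ (hcirc θ))) hδ ((I.γ * (c * M)) ^ p)
    refine ⟨N₀, fun N hN => ?_⟩
    filter_upwards [(hFK.mul_const B).eventually (hN₀ (N + 1) (by omega) (by omega))] with n hn
    refine hdiv ?_
    rw [hHroots]
    exact hn (W n) _ (hroots n θ)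
  · intro N n
    have hJ := sum_mul_log_le_circleAverage_modDet (N := N + 1) (F₀ n) hρ (m := m) (by omega) hA S
      (algebraicMultiplicity (A + K)) hS fun μ hμ => ?_
    · rw [Real.circleAverage_def, smul_eq_mul,
        intervalIntegral.integral_of_le Real.two_pi_pos.le] at hJ
      rw [hvol, integral_const_mul, mul_comm, ← le_inv_mul_iff₀ Real.two_pi_pos]
      rw [mul_left_comm, le_inv_mul_iff₀ (by positivity)]
      exact_mod_cast hJ
    · rw [hVm]
      have hle : V μ ≤ S.sup V := Finset.le_sup hμ
      refine finrank_le_analyticOrderAt_det_compressionMatrix (A := A) (K := K) (V := V μ)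
        (hle.trans le_sup_right) (fun v hv => hFV n v (hle hv)) (hV μ) (hVT μ)
        (inv_mul_cancel₀ (hS0 μ hμ)) ?_
      have h0 : μ⁻¹ ∈ closedBall (0 : ℂ) ρ := by simpa using hS μ hμ
      exact (continuous_const.sub (continuous_id.smul continuous_const)).continuousAt.eventually
          (Units.isOpen.mem_nhds (hA _ h0))

end Main

section Count

open Metric

theorem eigCount_eq_zero_of_subsingleton [Subsingleton X] (T : X →L[ℂ] X) (S : Set ℂ) :
    eigCount T S = 0 := by
  have : IsEmpty {μ : ℂ // μ ∈ S ∧ IsDiscreteEigenvalue T μ} :=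
    ⟨fun μ => by simpa [spectrum.of_subsingleton] using μ.2.2.1⟩
  exact tsum_empty

theorem eigCount_le_of_forall_finset {T : X →L[ℂ] X} {S : Set ℂ} {b : ℝ}
    (h : ∀ t : Finset ℂ, (∀ μ ∈ t, μ ∈ S) → ∑ μ ∈ t, (algebraicMultiplicity T μ : ℝ) ≤ b) :
    eigCount T S ≤ ENNReal.ofReal b := by
  rw [eigCount, ENNReal.tsum_eq_iSup_sum]
  refine iSup_le fun t => ?_
  have h1 := h (t.map (Function.Embedding.subtype _)) (by simp +contextual)
  rw [Finset.sum_map] at h1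
  calc ∑ μ ∈ t, (algebraicMultiplicity T (μ : ℂ) : ENNReal)
      = ENNReal.ofReal (∑ μ ∈ t, (algebraicMultiplicity T (μ : ℂ) : ℝ)) := by
        rw [ENNReal.ofReal_sum_of_nonneg fun _ _ => Nat.cast_nonneg _]
        simp
    _ ≤ ENNReal.ofReal b := ENNReal.ofReal_le_ofReal h1

theorem nonneg_of_resolvent_bound [Nontrivial X] {A : X →L[ℂ] X} {R C : ℝ}
    (hR : spectralRadius ℂ A ≤ ENNReal.ofReal R)
    (hres : ∀ z : ℂ, R < ‖z‖ → ‖resolvent A z‖ ≤ C / (‖z‖ - R)) : 0 ≤ R := by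
  by_contra! hneg
  have hmem : ∀ z : ℂ, z ≠ 0 → z ∈ resolventSet ℂ A := fun z hz => by
    refine spectrum.mem_resolventSet_of_spectralRadius_lt (hR.trans_lt ?_)
    rw [ENNReal.ofReal_of_nonpos hneg.le]
    simpa using hz
  have h0 : (0 : ℂ) ∈ spectrum ℂ A := by
    obtain ⟨μ, hμ⟩ := spectrum.nonempty A
    by_cases h : μ = 0
    · rwa [← h]
    · exact absurd (hmem μ h) hμ
  have hC : 0 ≤ C := by
    have h := (norm_nonneg _).trans (hres 0 (by simpa using hneg))
    rw [norm_zero, zero_sub] at h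
    by_contra! hC
    exact h.not_gt (div_neg_of_neg_of_pos hC (by linarith))
  obtain ⟨ε, hε, hεC⟩ : ∃ ε : ℝ, 0 < ε ∧ ε * (C / -R) < 1 := by
    have : 0 ≤ C / -R := div_nonneg hC (by linarith)
    refine ⟨(C / -R + 1)⁻¹, by positivity, ?_⟩
    rw [inv_mul_lt_iff₀ (by positivity)]
    linarith
  have hεne : (ε : ℂ) ≠ 0 := by exact_mod_cast hε.ne'
  have hεn : ‖(ε : ℂ)‖ = ε := by simp [abs_of_pos hε]
  have hlt : ‖(ε : ℂ) • resolvent A (ε : ℂ)‖ < 1 := by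
    rw [norm_smul, hεn]
    refine lt_of_le_of_lt ?_ hεC
    refine mul_le_mul_of_nonneg_left ((hres ε (by rw [hεn]; linarith)).trans ?_) hε.le
    rw [hεn]
    exact div_le_div_of_nonneg_left hC (by linarith) (by linarith)
  have hunit := (hmem ε hεne).mul (isUnit_one_sub_of_norm_lt_one hlt)
  have hcancel := Ring.mul_inverse_cancel _ (hmem ε hεne)
  have heq : (algebraMap ℂ (X →L[ℂ] X) ε - A) * (1 - (ε : ℂ) • resolvent A (ε : ℂ)) = -A := by
    rw [mul_sub, mul_one, mul_smul_comm, resolvent, hcancel, Algebra.algebraMap_eq_smul_one]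
    abel
  rw [heq] at hunit
  exact h0 (by rwa [spectrum.mem_resolventSet_iff, map_zero, zero_sub])

theorem isUnit_one_sub_smul_of_spectralRadius_le {A : X →L[ℂ] X} {R ρ : ℝ}
    (hR0 : 0 ≤ R) (hR : spectralRadius ℂ A ≤ ENNReal.ofReal R) (hRρ : R < ρ⁻¹) {w : ℂ}
    (hw : w ∈ closedBall (0 : ℂ) ρ) : IsUnit (1 - w • A) := by
  by_cases hw0 : w = 0
  · simp [hw0]
  rw [isUnit_one_sub_smul_iff hw0]
  refine spectrum.mem_resolventSet_of_spectralRadius_lt (hR.trans_lt ?_)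
  have h1 : ρ⁻¹ ≤ ‖w⁻¹‖ := by
    rw [norm_inv]
    exact inv_anti₀ (norm_pos_iff.mpr hw0) (by simpa using hw)
  rw [← enorm_eq_nnnorm, ← ofReal_norm]
  exact (ENNReal.ofReal_lt_ofReal_iff_of_nonneg hR0).mpr (hRρ.trans_le h1)

theorem norm_reciprocalResolvent_le {A : X →L[ℂ] X} {R C ρ : ℝ} (hρ : 0 < ρ) (hRρ : R < ρ⁻¹)
    (hres : ∀ z : ℂ, R < ‖z‖ → ‖resolvent A z‖ ≤ C / (‖z‖ - R)) {w : ℂ}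
    (hw : w ∈ sphere (0 : ℂ) ρ) : ‖reciprocalResolvent A w‖ ≤ C / (ρ⁻¹ - R) := by
  rw [mem_sphere_zero_iff_norm] at hw
  have hw0 : w ≠ 0 := norm_pos_iff.mp (hw ▸ hρ)
  have hn : ‖w⁻¹‖ = ρ⁻¹ := by rw [norm_inv, hw]
  rw [reciprocalResolvent_eq_resolvent hw0, ← hn]
  exact hres _ (by rwa [hn])

theorem optimal_radius_identity {p γ k C s R Γ : ℝ} (hp : 0 < p) (hγ : 0 ≤ γ) (hk : 0 ≤ k)
    (hC : 0 < C) (hs : R < s) :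
    Γ * (γ * (k * (C / ((s - R) * p / (p + 1))))) ^ p * s / ((s - R) / (p + 1)) =
      C ^ p * γ ^ p * Γ * ((p + 1) ^ (p + 1) / p ^ p) * (s / (s - R) ^ (p + 1)) * k ^ p := by
  have ht : 0 < s - R := sub_pos.mpr hs
  have hp1 : 0 < p + 1 := by linarith
  rw [Real.mul_rpow hγ (by positivity), Real.mul_rpow hk (by positivity),
    Real.div_rpow hC.le (by positivity), Real.div_rpow (by positivity) hp1.le,
    Real.mul_rpow ht.le hp.le, Real.rpow_add_one hp1.ne', Real.rpow_add_one ht.ne']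
  have h1 := Real.rpow_pos_of_pos hp1 p
  have h2 := Real.rpow_pos_of_pos ht p
  have h3 := Real.rpow_pos_of_pos hp p
  field_simp

end Count

/-- Let `I` be an `l_p`-ideal in `B(X)` with eigenvalue constant `γ`, let
`Γ > 0` satisfy the determinant bound for finite rank operators, let `A ∈ B(X)`, `K ∈ I`.
If `R ≥ r(A)` (the spectral radius of `A`), `C > 0` and
`‖(z-A)⁻¹‖ ≤ C/(|z|-R)` for `|z| > R`, then for every `s > R` the number of discrete
eigenvalues of `A+K` in `{z : |z| > s}`, counted with algebraic multiplicity, is at most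
`C^p γ^p Γ ((p+1)^{p+1}/p^p) · s/(s-R)^{p+1} · ‖K‖_I^p`. -/
theorem eigCount_outside_ball_le (p : ℝ) (hp : 0 < p) (I : LpIdeal p X)
    (Γ : ℝ) (hΓ : 0 < Γ)
    (hΓb : ∀ F : X →L[ℂ] X, IsFiniteRank F →
      ‖detp p F‖ ≤ Real.exp (Γ * (eigSum p F).toReal))
    (A K : X →L[ℂ] X) (hK : K ∈ I.carrier)
    (R C : ℝ) (hC : 0 < C) (hR : spectralRadius ℂ A ≤ ENNReal.ofReal R)
    (hres : ∀ z : ℂ, R < ‖z‖ → ‖resolvent A z‖ ≤ C / (‖z‖ - R)) :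
    ∀ s : ℝ, R < s →
      eigCount (A + K) {z : ℂ | s < ‖z‖} ≤
        ENNReal.ofReal (C ^ p * I.γ ^ p * Γ * ((p + 1) ^ (p + 1) / p ^ p) *
          (s / (s - R) ^ (p + 1)) * I.norm' K ^ p) := by
  intro s hs
  cases subsingleton_or_nontrivial X
  · rw [eigCount_eq_zero_of_subsingleton]
    exact zero_le
  have hR0 := nonneg_of_resolvent_bound hR hres
  have ht : 0 < s - R := sub_pos.mpr hs
  have hp1 : 0 < p + 1 := by linarith
  have hs0 : 0 < s := hR0.trans_lt hs
  set r := R + (s - R) * p / (p + 1) with hr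
  have hrR : r - R = (s - R) * p / (p + 1) := by rw [hr]; ring
  have hsr : s - r = (s - R) / (p + 1) := by rw [hr]; field_simp; ring
  have hRr : R < r := by
    have : 0 < (s - R) * p / (p + 1) := by positivity
    linarith
  have hrs : r < s := by
    have : 0 < (s - R) / (p + 1) := by positivity
    linarith
  have hr0 : 0 < r := hR0.trans_lt hRr
  have hrinv : R < r⁻¹⁻¹ := by rwa [inv_inv]
  refine eigCount_le_of_forall_finset fun t ht' => ?_
  have hlt : ∀ μ ∈ t, s < ‖μ‖ := ht'
  have hmain := sum_algebraicMultiplicity_mul_log_le hp I hΓ.le hΓb hK (inv_pos.mpr hr0)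
    (fun w => isUnit_one_sub_smul_of_spectralRadius_le hR0 hR hrinv)
    (fun w => norm_reciprocalResolvent_le (inv_pos.mpr hr0) hrinv hres) t
    (fun μ hμ => norm_pos_iff.mp (hs0.trans (hlt μ hμ)))
    (fun μ hμ => inv_anti₀ hr0 (hrs.trans (hlt μ hμ)).le)
  rw [inv_inv, hrR] at hmain
  rw [← optimal_radius_identity hp I.γ_nonneg (I.norm'_nonneg K hK) hC hs, ← hsr,
    le_div_iff₀ (sub_pos.mpr hrs), ← div_le_iff₀ hs0, mul_div_assoc, Finset.sum_mul]
  refine le_trans (Finset.sum_le_sum fun μ hμ => ?_) hmain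
  refine mul_le_mul_of_nonneg_left ?_ (Nat.cast_nonneg _)
  have h1 : s / r ≤ r⁻¹ * ‖μ‖ := by
    rw [div_eq_inv_mul]
    exact mul_le_mul_of_nonneg_left (hlt μ hμ).le (inv_nonneg.mpr hr0.le)
  calc (s - r) / s = 1 - (s / r)⁻¹ := by field_simp
    _ ≤ Real.log (s / r) := Real.one_sub_inv_le_log_of_pos (by positivity)
    _ ≤ Real.log (r⁻¹ * ‖μ‖) := Real.log_le_log (by positivity) h1
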